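/- Let f ∈ ℝ[x,y,z] be a smooth psd ternary quartic. Then the Gram spectrahedron Gram(f) has an extreme point of rank 4: there exists G ∈ Gram(f) with rank G = 4 such that G does not lie in the open segment between two distinct points of Gram(f). -/

import Mathlib

open MvPolynomial Matrix

/-- The monomial basis `x², y², z², xy, xz, yz` of `ℝ[x,y,z]₂`. -/
noncomputable def gramBasis : Fin 6 → MvPolynomial (Fin 3) ℝ :=
  ![X 0 ^ 2, X 1 ^ 2, X 2 ^ 2, X 0 * X 1, X 0 * X 2, X 1 * X 2]

/-- The Gram spectrahedron of `f`: all real symmetric psd `6×6` matrices `G` with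
`Σᵢⱼ gᵢⱼ·mᵢ·mⱼ = f` for the monomial basis `m` of `ℝ[x,y,z]₂`. -/
noncomputable def GramSpectrahedron (f : MvPolynomial (Fin 3) ℝ) :
    Set (Matrix (Fin 6) (Fin 6) ℝ) :=
  {G | G.PosSemidef ∧
    (∑ i, ∑ j, MvPolynomial.C (G i j) * (gramBasis i * gramBasis j)) = f}

/-- `f` is smooth: no nonzero complex point at which all partial derivatives of the
complexification of `f` vanish. -/
def IsSmooth (f : MvPolynomial (Fin 3) ℝ) : Prop :=
  ∀ a : Fin 3 → ℂ,
    (∀ i, eval a (pderiv i (map (algebraMap ℝ ℂ) f)) = 0) → a = 0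

/-- `f` is positive semidefinite on `ℝ³`. -/
def IsPsd (f : MvPolynomial (Fin 3) ℝ) : Prop :=
  ∀ a : Fin 3 → ℝ, 0 ≤ eval a f


/-- the Veronese vector of a point -/
def mv {R : Type*} [Semiring R] (v : Fin 3 → R) : Fin 6 → R :=
  ![v 0 * v 0, v 1 * v 1, v 2 * v 2, v 0 * v 1, v 0 * v 2, v 1 * v 2]

/-- symmetric matrix attached to a 6-vector -/
def sm {R : Type*} (a : Fin 6 → R) : Matrix (Fin 3) (Fin 3) R :=
  !![a 0, a 3, a 4; a 3, a 1, a 5; a 4, a 5, a 2]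

/-- coefficients of the product of two linear forms -/
def op {R : Type*} [Semiring R] (l m : Fin 3 → R) : Fin 6 → R :=
  ![l 0 * m 0, l 1 * m 1, l 2 * m 2, l 0 * m 1 + l 1 * m 0, l 0 * m 2 + l 2 * m 0,
    l 1 * m 2 + l 2 * m 1]

/-- matrix of a quadratic form given by its coefficients -/
noncomputable def qm (p : Fin 6 → ℝ) : Matrix (Fin 3) (Fin 3) ℝ :=
  !![p 0, p 3 / 2, p 4 / 2; p 3 / 2, p 1, p 5 / 2; p 4 / 2, p 5 / 2, p 2]

/-- moment matrices -/
def Hank (Y : Matrix (Fin 6) (Fin 6) ℝ) : Prop :=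
  Y 0 1 = Y 3 3 ∧ Y 0 2 = Y 4 4 ∧ Y 1 2 = Y 5 5 ∧ Y 4 5 = Y 2 3 ∧ Y 3 5 = Y 1 4 ∧ Y 3 4 = Y 0 5

lemma op_dot_sm {R : Type*} [CommRing R] (l m : Fin 3 → R) (a : Fin 6 → R) :
    op l m ⬝ᵥ a = l ⬝ᵥ (sm a *ᵥ m) := by
  simp [op, sm, dotProduct, mulVec, Fin.sum_univ_succ]
  ring

lemma op_dot_mv {R : Type*} [CommRing R] (l m : Fin 3 → R) (v : Fin 3 → R) :
    op l m ⬝ᵥ mv v = (l ⬝ᵥ v) * (m ⬝ᵥ v) := by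
  simp [op, mv, dotProduct, Fin.sum_univ_succ]
  ring

lemma bil_symm {Y : Matrix (Fin 6) (Fin 6) ℝ} (hY : Y.PosSemidef) (p q : Fin 6 → ℝ) :
    p ⬝ᵥ (Y *ᵥ q) = q ⬝ᵥ (Y *ᵥ p) := by
  have h : Yᵀ = Y := by simpa using hY.isHermitian.eq
  conv_lhs => rw [← h]
  rw [dotProduct_mulVec, vecMul_transpose, dotProduct_comm]

lemma psd_nonneg {n : Type*} [Fintype n] {Y : Matrix n n ℝ} (hY : Y.PosSemidef) (p : n → ℝ) :
    0 ≤ p ⬝ᵥ (Y *ᵥ p) := by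
  simpa using hY.dotProduct_mulVec_nonneg p

lemma psd_ker {n : Type*} [Fintype n] {Y : Matrix n n ℝ} (hY : Y.PosSemidef) {p : n → ℝ}
    (h : p ⬝ᵥ (Y *ᵥ p) = 0) : Y *ᵥ p = 0 := by
  classical
  have := (hY.dotProduct_mulVec_zero_iff p).1 (by simpa using h)
  exact this

lemma hank_swap {Y : Matrix (Fin 6) (Fin 6) ℝ} (hY : Y.PosSemidef) (hH : Hank Y)
    (l m l' m' : Fin 3 → ℝ) :
    op l m ⬝ᵥ (Y *ᵥ op l' m') = op l l' ⬝ᵥ (Y *ᵥ op m m') := by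
  have hs : ∀ i j, Y i j = Y j i := fun i j => by
    have := hY.isHermitian.apply i j
    simpa using this.symm
  obtain ⟨h1, h2, h3, h4, h5, h6⟩ := hH
  simp only [op, dotProduct, mulVec, Fin.sum_univ_six, Matrix.cons_val]
  rw [hs 1 0, hs 2 0, hs 3 0, hs 4 0, hs 5 0, hs 2 1, hs 3 1, hs 4 1, hs 5 1, hs 3 2, hs 4 2, hs 5 2,
    hs 4 3, hs 5 3, hs 5 4, h1, h2, h3, h4, h5, h6]
  ring

lemma op_comm (l m : Fin 3 → ℝ) : op l m = op m l := by
  ext i; fin_cases i <;> simp [op] <;> ring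

/-- a real binary quadratic form with nonpositive product of end coefficients has a zero -/
lemma bin_zero (a b c : ℝ) (h : a * c ≤ 0) :
    ∃ s t : ℝ, (s ≠ 0 ∨ t ≠ 0) ∧ a * s ^ 2 + 2 * b * s * t + c * t ^ 2 = 0 := by
  by_cases ha : a = 0
  · exact ⟨1, 0, by simp, by simp [ha]⟩
  · refine ⟨-b + √(b ^ 2 - a * c), a, Or.inr ha, ?_⟩
    have := Real.sq_sqrt (show 0 ≤ b ^ 2 - a * c by nlinarith [sq_nonneg b])
    linear_combination a * this

/-- Lemma T -/
lemma traceless {Y : Matrix (Fin 6) (Fin 6) ℝ} (hY : Y.PosSemidef) (p q r : Fin 6 → ℝ)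
    (hp : Y *ᵥ p ≠ 0) (h : p ⬝ᵥ (Y *ᵥ r) = q ⬝ᵥ (Y *ᵥ q)) :
    ∃ s t : ℝ, Y *ᵥ (s • p + t • q) ≠ 0 ∧
      (p ⬝ᵥ (Y *ᵥ (s • p + t • q))) * (r ⬝ᵥ (Y *ᵥ (s • p + t • q)))
        = (q ⬝ᵥ (Y *ᵥ (s • p + t • q))) ^ 2 := by
  have hpp : 0 < p ⬝ᵥ (Y *ᵥ p) :=
    lt_of_le_of_ne (psd_nonneg hY p) (fun h' => hp (psd_ker hY h'.symm))
  have e1 := bil_symm hY q p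
  have e2 := bil_symm hY r p
  have e3 := bil_symm hY r q
  set A := p ⬝ᵥ (Y *ᵥ p) with hA
  set B := p ⬝ᵥ (Y *ᵥ q) with hB
  set C := q ⬝ᵥ (Y *ᵥ q) with hC
  set D := q ⬝ᵥ (Y *ᵥ r) with hD
  have key : ∀ s t : ℝ, (s • p + t • q) ⬝ᵥ (Y *ᵥ (s • p + t • q))
      = s ^ 2 * A + 2 * s * t * B + t ^ 2 * C := by
    intro s t
    simp only [mulVec_add, mulVec_smul, dotProduct_add, add_dotProduct, smul_dotProduct,
      dotProduct_smul, smul_eq_mul, e1, ← hA, ← hB, ← hC]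
    ring
  -- discriminant
  have hCS : 0 ≤ A * C - B ^ 2 := by
    have := psd_nonneg hY ((-B) • p + A • q)
    rw [key] at this
    have h2 : 0 ≤ A * (A * C - B ^ 2) := by linarith
    exact nonneg_of_mul_nonneg_right h2 hpp
  have val : ∀ s t : ℝ, (p ⬝ᵥ (Y *ᵥ (s • p + t • q))) * (r ⬝ᵥ (Y *ᵥ (s • p + t • q)))
        - (q ⬝ᵥ (Y *ᵥ (s • p + t • q))) ^ 2
      = (s * A + t * B) * (s * C + t * D) - (s * B + t * C) ^ 2 := by
    intro s t
    simp only [mulVec_add, mulVec_smul, dotProduct_add,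
      dotProduct_smul, smul_eq_mul, e1, e2, e3, h, ← hA, ← hB, ← hC, ← hD]
  have fin : ∀ s t : ℝ, s ^ 2 * A + 2 * s * t * B + t ^ 2 * C ≠ 0 →
      (s * A + t * B) * (s * C + t * D) - (s * B + t * C) ^ 2 = 0 → ∃ s t : ℝ,
      Y *ᵥ (s • p + t • q) ≠ 0 ∧
      (p ⬝ᵥ (Y *ᵥ (s • p + t • q))) * (r ⬝ᵥ (Y *ᵥ (s • p + t • q)))
        = (q ⬝ᵥ (Y *ᵥ (s • p + t • q))) ^ 2 := by
    intro s t h1 h2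
    refine ⟨s, t, fun h0 => h1 ?_, ?_⟩
    · rw [← key, h0, dotProduct_zero]
    · rw [← sub_eq_zero, val, h2]
  rcases hCS.eq_or_lt with h0 | h0
  · refine fin 1 0 (by simpa using hpp.ne') ?_
    linarith
  · -- w = s p + t (A q - B p)
    set E := A * C - B ^ 2 with hE
    -- Q(p) = E ; Q(A q - B p) = - (A q - B p, q)^2 = -E^2
    obtain ⟨s, t, hst, hz⟩ := bin_zero E ((A * (E * 0 + (-B * C + A * D)) - 2 * B * E) / 2) (-E ^ 2)
      (by nlinarith [pow_pos h0 3])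
    refine fin (s - t * B) (t * A) ?_ ?_
    · have : (s - t * B) ^ 2 * A + 2 * (s - t * B) * (t * A) * B + (t * A) ^ 2 * C
          = A * (s ^ 2 + t ^ 2 * E) := by rw [hE]; ring
      rw [this]
      have : 0 < s ^ 2 + t ^ 2 * E := by
        rcases hst with hs | ht
        · have := mul_nonneg (sq_nonneg t) h0.le
          positivity
        · have := sq_nonneg s
          positivity
      positivity
    · rw [← hz, hE]; ring

/-- nonnegative or nonpositive rank one decomposition -/
lemma rank_one_param (a b c : ℝ) (h : a * c = b ^ 2) :
    ∃ e x y : ℝ, (e = 1 ∨ e = -1) ∧ a = e * x ^ 2 ∧ b = e * (x * y) ∧ c = e * y ^ 2 := by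
  by_cases ha : a = 0
  · have hb : b = 0 := by
      have : b ^ 2 = 0 := by rw [← h, ha, zero_mul]
      exact pow_eq_zero_iff (two_ne_zero) |>.1 this
    rcases le_total 0 c with hc | hc
    · exact ⟨1, 0, √c, Or.inl rfl, by simp [ha], by simp [hb], by simp [Real.sq_sqrt hc]⟩
    · exact ⟨-1, 0, √(-c), Or.inr rfl, by simp [ha], by simp [hb],
        by rw [Real.sq_sqrt (by linarith)]; ring⟩
  · rcases lt_or_gt_of_ne ha with hc | hc
    · have hx := Real.sq_sqrt (show 0 ≤ -a by linarith)
      have hx0 : √(-a) ≠ 0 := by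
        intro h0; rw [h0] at hx; apply ha; linarith
      refine ⟨-1, √(-a), -b / √(-a), Or.inr rfl, by rw [hx]; ring, by field_simp, ?_⟩
      rw [div_pow, hx]; field_simp; linarith
    · have hx := Real.sq_sqrt hc.le
      have hx0 : √a ≠ 0 := by
        intro h0; rw [h0] at hx; apply ha; linarith
      refine ⟨1, √a, b / √a, Or.inl rfl, by rw [hx]; ring, by field_simp, ?_⟩
      rw [div_pow, hx]; field_simp; linarith

lemma exists_third {F : Type*} [Field F] {l m : Fin 3 → F} (h : LinearIndependent F ![l, m]) :
    ∃ n : Fin 3 → F, (Matrix.of ![n, l, m]).det ≠ 0 := by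
  have hn : ∃ n : Fin 3 → F, n ∉ Submodule.span F (Set.range ![l, m]) := by
    by_contra hcon
    push Not at hcon
    have htop : Submodule.span F (Set.range ![l, m]) = ⊤ := by
      rw [eq_top_iff]; intro x _; exact hcon x
    have h1 := finrank_span_eq_card h
    rw [htop] at h1
    simp at h1
  obtain ⟨n, hn⟩ := hn
  refine ⟨n, ?_⟩
  have h2 : LinearIndependent F ![n, l, m] := by
    apply LinearIndependent.finCons h hn
  have h3 : LinearIndependent F (Matrix.of ![n, l, m]).row := h2
  rw [Matrix.linearIndependent_rows_iff_isUnit, Matrix.isUnit_iff_isUnit_det] at h3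
  exact h3.ne_zero

lemma pair_swap {F : Type*} [Field F] {l m : Fin 3 → F} (h : LinearIndependent F ![l, m]) :
    LinearIndependent F ![m, l] := by
  rw [LinearIndependent.pair_iff] at h ⊢
  intro s t hst
  have := h t s (by rw [add_comm]; exact hst)
  exact ⟨this.2, this.1⟩

/-- congruence is injective -/
lemma congr_zero {F : Type*} [Field F] {Q S : Matrix (Fin 3) (Fin 3) F} (hQ : Q.det ≠ 0)
    (h : Q * S * Qᵀ = 0) : S = 0 := by
  have hu : IsUnit Q.det := hQ.isUnit
  have hu' : IsUnit Qᵀ.det := by rwa [det_transpose]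
  have h2 : Q⁻¹ * (Q * S * Qᵀ) * Qᵀ⁻¹ = S := by
    rw [Matrix.mul_assoc Q S, Matrix.nonsing_inv_mul_cancel_left _ _ hu,
      Matrix.mul_nonsing_inv_cancel_right _ _ hu']
  rw [← h2, h]; simp

lemma congr_entry {F : Type*} [CommRing F] (Q : Matrix (Fin 3) (Fin 3) F) (a : Fin 6 → F)
    (i j : Fin 3) : (Q * sm a * Qᵀ) i j = op (Q i) (Q j) ⬝ᵥ a := by
  rw [op_dot_sm, Matrix.mul_assoc, Matrix.mul_apply]
  simp only [dotProduct, mulVec, Matrix.mul_apply, transpose_apply]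

lemma sm_mv {F : Type*} [CommRing F] (v : Fin 3 → F) : sm (mv v) = vecMulVec v v := by
  ext i j; fin_cases i <;> fin_cases j <;> simp [sm, mv, vecMulVec_apply] <;> ring

lemma sm_inj {F : Type*} {a b : Fin 6 → F} (h : sm a = sm b) : a = b := by
  have e := fun i j => congrFun (congrFun h i) j
  ext k
  fin_cases k
  · simpa [sm] using e 0 0
  · simpa [sm] using e 1 1
  · simpa [sm] using e 2 2
  · simpa [sm] using e 0 1
  · simpa [sm] using e 0 2
  · simpa [sm] using e 1 2

/-- the vector is Veronese if it is so in a basis -/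
lemma veronese_of_basis {F : Type*} [Field F] {l m n : Fin 3 → F}
    (hQ : (Matrix.of ![n, l, m]).det ≠ 0) {a : Fin 6 → F} (e x y z : F)
    (hll : op l l ⬝ᵥ a = e * (x * x)) (hln : op l n ⬝ᵥ a = e * (x * y))
    (hnn : op n n ⬝ᵥ a = e * (y * y))
    (hlm : op l m ⬝ᵥ a = e * (x * z)) (hmn : op m n ⬝ᵥ a = e * (y * z))
    (hmm : op m m ⬝ᵥ a = e * (z * z)) :
    ∃ v, a = e • mv v := by
  have opc : ∀ u w : Fin 3 → F, op u w = op w u := by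
    intro u w; ext i; fin_cases i <;> simp [op] <;> ring
  set Q := Matrix.of ![n, l, m] with hQd
  set v := Q⁻¹ *ᵥ ![y, x, z] with hv
  have hQv : Q *ᵥ v = ![y, x, z] := by
    rw [hv, mulVec_mulVec, Matrix.mul_nonsing_inv _ hQ.isUnit, one_mulVec]
  refine ⟨v, ?_⟩
  have hnv : n ⬝ᵥ v = y := by simpa [hQd, mulVec] using congrFun hQv 0
  have hlv : l ⬝ᵥ v = x := by simpa [hQd, mulVec] using congrFun hQv 1
  have hmv : m ⬝ᵥ v = z := by simpa [hQd, mulVec] using congrFun hQv 2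
  have hd : sm (a - e • mv v) = 0 := by
    apply congr_zero hQ
    ext i j
    rw [congr_entry, dotProduct_sub, dotProduct_smul, op_dot_mv]
    have r0 : Q 0 = n := rfl
    have r1 : Q 1 = l := rfl
    have r2 : Q 2 = m := rfl
    fin_cases i <;> fin_cases j <;>
      simp only [Fin.zero_eta, Fin.mk_one, Fin.reduceFinMk, r0, r1, r2, hnv, hlv, hmv, hll, hnn,
        hmm, hln, opc n l, hlm, opc m l, hmn, opc n m, smul_eq_mul, Matrix.zero_apply] <;> ring
  have h0 : sm (0 : Fin 6 → F) = 0 := by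
    ext i j; fin_cases i <;> fin_cases j <;> simp [sm]
  rw [← h0] at hd
  exact sub_eq_zero.1 (sm_inj hd)

lemma mv_zero {F : Type*} [Semiring F] : mv (0 : Fin 3 → F) = 0 := by
  ext i; fin_cases i <;> simp [mv]

/-- descending direction -/
def Good (Y : Matrix (Fin 6) (Fin 6) ℝ) : Prop :=
  ∃ v : Fin 3 → ℝ, v ≠ 0 ∧ ∃ w, Y *ᵥ w = mv v

lemma good_of_w {Y : Matrix (Fin 6) (Fin 6) ℝ} {l m n : Fin 3 → ℝ}
    (hQ : (Matrix.of ![n, l, m]).det ≠ 0) (w : Fin 6 → ℝ) (hw : Y *ᵥ w ≠ 0)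
    (hlm : op l m ⬝ᵥ (Y *ᵥ w) = 0) (hmm : op m m ⬝ᵥ (Y *ᵥ w) = 0)
    (hmn : op m n ⬝ᵥ (Y *ᵥ w) = 0)
    (hr : (op l l ⬝ᵥ (Y *ᵥ w)) * (op n n ⬝ᵥ (Y *ᵥ w)) = (op l n ⬝ᵥ (Y *ᵥ w)) ^ 2) : Good Y := by
  obtain ⟨e, x, y, he, h1, h2, h3⟩ := rank_one_param _ _ _ hr
  obtain ⟨v, hv⟩ := veronese_of_basis hQ e x y 0 (by rw [h1]; ring) h2 (by rw [h3]; ring)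
    (by rw [hlm]; ring) (by rw [hmn]; ring) (by rw [hmm]; ring)
  refine ⟨v, ?_, e • w, ?_⟩
  · rintro rfl
    apply hw
    rw [hv, mv_zero, smul_zero]
  · rw [mulVec_smul, hv, smul_smul]
    rcases he with rfl | rfl <;> simp

lemma good_half {Y : Matrix (Fin 6) (Fin 6) ℝ} (hY : Y.PosSemidef) (hH : Hank Y)
    {l m n : Fin 3 → ℝ} (hQ : (Matrix.of ![n, l, m]).det ≠ 0) (h : Y *ᵥ op l m = 0)
    (hl : Y *ᵥ op l l ≠ 0) : Good Y := by
  obtain ⟨s, t, h1, h2⟩ := traceless hY (op l l) (op l n) (op n n) hl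
    (by rw [hank_swap hY hH])
  have k1 : ∀ a b : Fin 3 → ℝ, op a b ⬝ᵥ (Y *ᵥ op l m) = 0 := fun a b => by rw [h]; simp
  refine good_of_w hQ _ h1 ?_ ?_ ?_ (by rw [h2])
  · rw [bil_symm hY, h, dotProduct_zero]
  · have e1 : op m m ⬝ᵥ (Y *ᵥ op l l) = 0 := by
      rw [hank_swap hY hH, op_comm m l, h, dotProduct_zero]
    have e2 : op m m ⬝ᵥ (Y *ᵥ op l n) = 0 := by
      rw [hank_swap hY hH, op_comm m l, bil_symm hY, h, dotProduct_zero]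
    rw [mulVec_add, mulVec_smul, mulVec_smul, dotProduct_add, dotProduct_smul, dotProduct_smul,
      e1, e2]; simp
  · have e1 : op m n ⬝ᵥ (Y *ᵥ op l l) = 0 := by
      rw [hank_swap hY hH, op_comm m l, bil_symm hY, h, dotProduct_zero]
    have e2 : op m n ⬝ᵥ (Y *ᵥ op l n) = 0 := by
      rw [hank_swap hY hH, op_comm m l, bil_symm hY, h, dotProduct_zero]
    rw [mulVec_add, mulVec_smul, mulVec_smul, dotProduct_add, dotProduct_smul, dotProduct_smul,
      e1, e2]; simp

lemma ker_ln {Y : Matrix (Fin 6) (Fin 6) ℝ} (hY : Y.PosSemidef) (hH : Hank Y)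
    {l : Fin 3 → ℝ} (n : Fin 3 → ℝ) (h : Y *ᵥ op l l = 0) : Y *ᵥ op l n = 0 := by
  apply psd_ker hY
  rw [hank_swap hY hH, bil_symm hY, h, dotProduct_zero]

lemma op_expand {l m n : Fin 3 → ℝ} (hQ : (Matrix.of ![n, l, m]).det ≠ 0) {a : Fin 6 → ℝ}
    (h1 : op l l ⬝ᵥ a = 0) (h2 : op l m ⬝ᵥ a = 0) (h3 : op l n ⬝ᵥ a = 0) (h4 : op m m ⬝ᵥ a = 0)
    (h5 : op m n ⬝ᵥ a = 0) (h6 : op n n ⬝ᵥ a = 0) : a = 0 := by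
  obtain ⟨v, hv⟩ := veronese_of_basis hQ (a := a) 0 0 0 0 (by simpa) (by simpa) (by simpa)
    (by simpa) (by simpa) (by simpa)
  simpa using hv

lemma good_of_red {Y : Matrix (Fin 6) (Fin 6) ℝ} (hY : Y.PosSemidef) (hH : Hank Y) (h0 : Y ≠ 0)
    {l m : Fin 3 → ℝ} (hlm : LinearIndependent ℝ ![l, m]) (h : Y *ᵥ op l m = 0) : Good Y := by
  obtain ⟨n, hQ⟩ := exists_third hlm
  by_cases hl : Y *ᵥ op l l = 0
  · by_cases hm : Y *ᵥ op m m = 0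
    · have hln := ker_ln hY hH n hl
      have hmn := ker_ln hY hH n hm
      have z : ∀ p, Y *ᵥ p = 0 → p ⬝ᵥ (Y *ᵥ op n n) = 0 := fun p hp => by
        rw [bil_symm hY, hp, dotProduct_zero]
      refine good_of_w hQ (op n n) ?_ (z _ h) (z _ hm) (z _ hmn) (by rw [z _ hl, z _ hln]; simp)
      intro hnn
      apply h0
      ext i j
      have key : ∀ p, Y *ᵥ p = 0 := by
        intro p
        have z' : ∀ q, Y *ᵥ q = 0 → q ⬝ᵥ (Y *ᵥ p) = 0 := fun q hq => by
          rw [bil_symm hY, hq, dotProduct_zero]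
        exact op_expand hQ (z' _ hl) (z' _ h) (z' _ hln) (z' _ hm) (z' _ hmn) (z' _ hnn)
      have := congrFun (key (Pi.single j 1)) i
      simpa using this
    · obtain ⟨n', hQ'⟩ := exists_third (pair_swap hlm)
      exact good_half hY hH hQ' (by rwa [op_comm]) hm
  · exact good_half hY hH hQ h hl

lemma good_of_sq {Y : Matrix (Fin 6) (Fin 6) ℝ} (hY : Y.PosSemidef) (hH : Hank Y) (h0 : Y ≠ 0)
    {l m : Fin 3 → ℝ} (hlm : LinearIndependent ℝ ![l, m]) (h : Y *ᵥ op l l = 0) : Good Y :=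
  good_of_red hY hH h0 hlm (ker_ln hY hH m h)

lemma qm_op (l : Fin 3 → ℝ) (i j : Fin 3) : qm (op l l) i j = l i * l j := by
  fin_cases i <;> fin_cases j <;> simp [qm, op] <;> ring

lemma qm_add (p q : Fin 6 → ℝ) : qm (p + q) = qm p + qm q := by
  ext i j; fin_cases i <;> fin_cases j <;> simp [qm] <;> ring
lemma qm_smul (c : ℝ) (p : Fin 6 → ℝ) : qm (c • p) = c • qm p := by
  ext i j; fin_cases i <;> fin_cases j <;> simp [qm] <;> ring

lemma qm_inj {a b : Fin 6 → ℝ} (h : qm a = qm b) : a = b := by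
  have e := fun i j => congrFun (congrFun h i) j
  have e1 := e 0 0
  have e2 := e 1 1
  have e3 := e 2 2
  have e4 := e 0 1
  have e5 := e 0 2
  have e6 := e 1 2
  simp [qm] at e1 e2 e3 e4 e5 e6
  ext k
  fin_cases k <;> simp <;> linarith

lemma qm_diag (p : Fin 6 → ℝ) : ∃ (b : Fin 3 → Fin 3 → ℝ) (d : Fin 3 → ℝ),
    (∀ i j, b i ⬝ᵥ b j = if i = j then 1 else 0) ∧
    p = d 0 • op (b 0) (b 0) + d 1 • op (b 1) (b 1) + d 2 • op (b 2) (b 2) ∧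
    (qm p).det = d 0 * d 1 * d 2 := by
  have hH : (qm p).IsHermitian := by
    ext i j; fin_cases i <;> fin_cases j <;> simp [qm]
  refine ⟨fun k => (hH.eigenvectorBasis k).ofLp, hH.eigenvalues, ?_, ?_, ?_⟩
  · intro i j
    have := (orthonormal_iff_ite.1 hH.eigenvectorBasis.orthonormal) j i
    simp only [EuclideanSpace.inner_eq_star_dotProduct, star_trivial] at this
    rw [this]; simp [eq_comm]
  · apply qm_inj
    have h := hH.spectral_theorem
    ext i j
    rw [qm_add, qm_add, qm_smul, qm_smul, qm_smul]
    simp only [Matrix.add_apply, Matrix.smul_apply, qm_op, smul_eq_mul]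
    have hij := congrFun (congrFun h i) j
    rw [hij]
    simp [Unitary.conjStarAlgAut_apply, Matrix.mul_apply, Fin.sum_univ_three, diagonal,
      IsHermitian.eigenvectorUnitary_apply, Matrix.star_apply]
    ring
  · rw [hH.det_eq_prod_eigenvalues, Fin.prod_univ_three]; simp

lemma exists_singular (W : Submodule ℝ (Fin 6 → ℝ)) (hW : 2 ≤ Module.finrank ℝ W) :
    ∃ p ∈ W, p ≠ 0 ∧ (qm p).det = 0 := by
  obtain ⟨g, hg⟩ := exists_linearIndependent_of_le_finrank hW
  have hp := hg
  have hpq : LinearIndependent ℝ ![g 0, g 1] := by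
    convert hg using 1
    ext i; fin_cases i <;> rfl
  rw [LinearIndependent.pair_iff] at hpq
  set p : ℝ → Fin 6 → ℝ := fun θ => Real.cos θ • (g 0 : Fin 6 → ℝ) + Real.sin θ • (g 1 : Fin 6 → ℝ)
  have hpd : ∀ θ, p θ = Real.cos θ • (g 0 : Fin 6 → ℝ) + Real.sin θ • (g 1 : Fin 6 → ℝ) := fun _ => rfl
  have hcont : Continuous (fun θ => (qm (p θ)).det) := by
    simp only [det_fin_three, qm, hpd]
    simp
    fun_prop
  have hπ : (qm (p Real.pi)).det = - (qm (p 0)).det := by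
    have : p Real.pi = (-1 : ℝ) • p 0 := by simp [hpd]
    rw [this, qm_smul, det_smul]; simp; norm_num
  have hz : ∃ θ, (qm (p θ)).det = 0 := by
    rcases le_total 0 ((qm (p 0)).det) with h | h
    · have := mem_range_of_exists_le_of_exists_ge hcont (c := 0) ⟨Real.pi, by linarith⟩ ⟨0, h⟩
      exact this
    · have := mem_range_of_exists_le_of_exists_ge hcont (c := 0) ⟨0, h⟩ ⟨Real.pi, by linarith⟩
      exact this
  obtain ⟨θ, hθ⟩ := hz
  refine ⟨p θ, W.add_mem (W.smul_mem _ (g 0).2) (W.smul_mem _ (g 1).2), fun h0 => ?_, hθ⟩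
  have := hpq (Real.cos θ) (Real.sin θ) (by apply Subtype.ext; simpa [hpd] using h0)
  have h1 := Real.sin_sq_add_cos_sq θ
  rw [this.1, this.2] at h1
  norm_num at h1

lemma pair_indep {b : Fin 3 → Fin 3 → ℝ} (hb : ∀ i j, b i ⬝ᵥ b j = if i = j then 1 else 0)
    {i j : Fin 3} (hij : i ≠ j) (s t s' t' : ℝ) (hd : s * t' - t * s' ≠ 0) :
    LinearIndependent ℝ ![s • b i + t • b j, s' • b i + t' • b j] := by
  rw [LinearIndependent.pair_iff]
  intro x y h
  have h1 := congrArg (fun z => b i ⬝ᵥ z) h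
  have h2 := congrArg (fun z => b j ⬝ᵥ z) h
  simp [dotProduct_add, dotProduct_smul, hb, hij, hij.symm] at h1 h2
  constructor
  · have : x * (s * t' - t * s') = 0 := by linear_combination t' * h1 - s' * h2
    exact (mul_eq_zero.1 this).resolve_right hd
  · have : y * (s * t' - t * s') = 0 := by linear_combination s * h2 - t * h1
    exact (mul_eq_zero.1 this).resolve_right hd

lemma range_of_perp {Y : Matrix (Fin 6) (Fin 6) ℝ} (hY : Y.PosSemidef) (c : Fin 6 → ℝ)
    (h : ∀ p, Y *ᵥ p = 0 → p ⬝ᵥ c = 0) : ∃ w, Y *ᵥ w = c := by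
  have hT : Yᵀ = Y := by simpa using hY.isHermitian.eq
  by_contra hcon
  push Not at hcon
  have hc : c ∉ LinearMap.range Y.mulVecLin := by
    rintro ⟨w, hw⟩; exact hcon w (by simpa using hw)
  obtain ⟨φ, hφ1, hφ2⟩ := Submodule.exists_le_ker_of_notMem hc
  -- φ is a dot product
  set p : Fin 6 → ℝ := fun i => φ (Pi.single i 1) with hp
  have hφ : ∀ x, φ x = p ⬝ᵥ x := by
    intro x
    conv_lhs => rw [LinearMap.pi_apply_eq_sum_univ φ x]
    simp only [dotProduct, hp, smul_eq_mul]
    refine Finset.sum_congr rfl fun i _ => ?_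
    rw [mul_comm]
    congr 2
    ext j; simp [Pi.single_apply, eq_comm]
  have hYp : Y *ᵥ p = 0 := by
    ext i
    have h1 : φ (Y *ᵥ Pi.single i 1) = 0 := by
      have : Y *ᵥ Pi.single i 1 ∈ LinearMap.range Y.mulVecLin := ⟨Pi.single i 1, by simp⟩
      exact hφ2 this
    rw [hφ, bil_symm hY] at h1
    simpa using h1
  have := h p hYp
  rw [← hφ] at this
  exact hφ1 this

lemma op_bilin (l m : Fin 3 → ℝ) (s t : ℝ) :
    op (s • l + t • m) (s • l + (-t) • m) = s ^ 2 • op l l + (-(t ^ 2)) • op m m := by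
  ext i; fin_cases i <;> simp [op] <;> ring

lemma good_all {Y : Matrix (Fin 6) (Fin 6) ℝ} (hY : Y.PosSemidef) (hH : Hank Y) (h0 : Y ≠ 0) :
    Good Y := by
  by_cases hker : ∀ p, Y *ᵥ p = 0 → p = 0
  · obtain ⟨w, hw⟩ := range_of_perp hY (mv (Pi.single 0 1)) (fun p hp => by simp [hker p hp])
    exact ⟨Pi.single 0 1, by simp, w, hw⟩
  push Not at hker
  set W := LinearMap.ker Y.mulVecLin with hW
  have hmem : ∀ p, p ∈ W ↔ Y *ᵥ p = 0 := fun p => by simp [hW]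
  have hp : ∃ p, Y *ᵥ p = 0 ∧ p ≠ 0 ∧ (2 ≤ Module.finrank ℝ W → (qm p).det = 0) := by
    by_cases h2 : 2 ≤ Module.finrank ℝ W
    · obtain ⟨p, h1, h3, h4⟩ := exists_singular W h2
      exact ⟨p, (hmem p).1 h1, h3, fun _ => h4⟩
    · obtain ⟨p, h1, h3⟩ := hker
      exact ⟨p, h1, h3, fun h => absurd h h2⟩
  obtain ⟨p, hYp, hp0, hdet⟩ := hp
  obtain ⟨b, d, hb, hpd, hd⟩ := qm_diag p
  have hpd' : ∀ i j k : Fin 3, i ≠ j → i ≠ k → j ≠ k →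
      p = d i • op (b i) (b i) + d j • op (b j) (b j) + d k • op (b k) (b k) := by
    intro i j k h1 h2 h3
    rw [hpd]
    fin_cases i <;> fin_cases j <;> fin_cases k <;> simp at h1 h2 h3 ⊢ <;> abel
  have hd' : ∀ i j k : Fin 3, i ≠ j → i ≠ k → j ≠ k → (qm p).det = d i * d j * d k := by
    intro i j k h1 h2 h3
    rw [hd]
    fin_cases i <;> fin_cases j <;> fin_cases k <;> first
      | exact absurd rfl h1
      | exact absurd rfl h2
      | exact absurd rfl h3
      | (dsimp <;> ring)
  have third : ∀ i j : Fin 3, i ≠ j → ∃ k, i ≠ k ∧ j ≠ k := by decide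
  have key : ∀ q, q ⬝ᵥ (Y *ᵥ p) = 0 := fun q => by rw [hYp, dotProduct_zero]
  by_cases hmix : ∃ i j, 0 < d i ∧ d j < 0
  · obtain ⟨i, j, hi, hj⟩ := hmix
    have hij : i ≠ j := by rintro rfl; linarith
    obtain ⟨k, hik, hjk⟩ := third i j hij
    have si := Real.sq_sqrt hi.le
    have sj := Real.sq_sqrt (show 0 ≤ - d j by linarith)
    have pi : 0 < √(d i) := Real.sqrt_pos.2 hi
    have pj : 0 < √(-d j) := Real.sqrt_pos.2 (by linarith)
    by_cases h2 : 2 ≤ Module.finrank ℝ W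
    · have hdk : d k = 0 := by
        have := hdet h2
        rw [hd' i j k hij hik hjk] at this
        have h3 : d i * d j ≠ 0 := mul_ne_zero hi.ne' hj.ne
        exact (mul_eq_zero.1 this).resolve_left h3
      have hpe : p = op (√(d i) • b i + √(-d j) • b j) (√(d i) • b i + (-√(-d j)) • b j) := by
        rw [op_bilin, si, sj, hpd' i j k hij hik hjk, hdk]; simp
      refine good_of_red hY hH h0 (pair_indep hb hij (√(d i)) (√(-d j)) (√(d i)) (-√(-d j)) ?_)
        (by rw [← hpe, hYp])
      have := mul_pos pi pj
      intro h; linarith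
    · have hv : p ⬝ᵥ mv (√(-d j) • b i + √(d i) • b j) = 0 := by
        rw [hpd' i j k hij hik hjk]
        simp only [add_dotProduct, smul_dotProduct, op_dot_mv, dotProduct_add, dotProduct_smul, hb,
          hij, hij.symm, hik.symm, hjk.symm]
        simp
        linear_combination d i * sj + d j * si
      obtain ⟨w, hw⟩ := range_of_perp hY (mv (√(-d j) • b i + √(d i) • b j)) (by
        intro q hq
        have hf : Module.finrank ℝ W ≤ 1 := by omega
        have hs := (finrank_le_one_iff.1 hf)
        obtain ⟨u, hu⟩ := hs
        obtain ⟨c1, hc1⟩ := hu ⟨p, (hmem p).2 hYp⟩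
        obtain ⟨c2, hc2⟩ := hu ⟨q, (hmem q).2 hq⟩
        have e1 : c1 • (u : Fin 6 → ℝ) = p := congrArg Subtype.val hc1
        have e2 : c2 • (u : Fin 6 → ℝ) = q := congrArg Subtype.val hc2
        have hc0 : c1 ≠ 0 := by rintro rfl; apply hp0; rw [← e1, zero_smul]
        rw [← e1, smul_dotProduct, smul_eq_mul] at hv
        rw [← e2, smul_dotProduct, (mul_eq_zero.1 hv).resolve_left hc0, smul_zero])
      refine ⟨_, ?_, w, hw⟩
      intro h
      have := congrArg (fun z => b i ⬝ᵥ z) h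
      simp [dotProduct_add, dotProduct_smul, hb, hij] at this
      exact pj.ne' this
  · push Not at hmix
    have hne : ∃ i, d i ≠ 0 := by
      by_contra hcon
      push Not at hcon
      apply hp0; rw [hpd]; simp [hcon]
    obtain ⟨i, hi⟩ := hne
    obtain ⟨j, k, hij, hik, hjk⟩ : ∃ j k, i ≠ j ∧ i ≠ k ∧ j ≠ k := by
      have : ∀ i : Fin 3, ∃ j k : Fin 3, i ≠ j ∧ i ≠ k ∧ j ≠ k := by decide
      exact this i
    have h1 := key (op (b i) (b i))
    rw [hpd' i j k hij hik hjk] at h1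
    simp only [mulVec_add, mulVec_smul, dotProduct_add, dotProduct_smul, smul_eq_mul] at h1
    have n1 := psd_nonneg hY (op (b i) (b i))
    have n2 := psd_nonneg hY (op (b i) (b j))
    have n3 := psd_nonneg hY (op (b i) (b k))
    rw [hank_swap hY hH (b i) (b i) (b j) (b j), hank_swap hY hH (b i) (b i) (b k) (b k)] at h1
    have hz : op (b i) (b i) ⬝ᵥ (Y *ᵥ op (b i) (b i)) = 0 := by
      rcases lt_or_gt_of_ne hi with h | h
      · have hj : d j ≤ 0 := by
          by_contra hc; exact absurd h (not_lt.2 (hmix j i (not_le.1 hc)))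
        have hk : d k ≤ 0 := by
          by_contra hc; exact absurd h (not_lt.2 (hmix k i (not_le.1 hc)))
        have := mul_nonneg (neg_nonneg.2 hj) n2
        have := mul_nonneg (neg_nonneg.2 hk) n3
        have h3 : d i * (op (b i) (b i) ⬝ᵥ (Y *ᵥ op (b i) (b i))) = 0 := by
          have := mul_nonneg (neg_nonneg.2 h.le) n1
          linarith
        exact (mul_eq_zero.1 h3).resolve_left hi
      · have hj := hmix i j h
        have hk := hmix i k h
        have := mul_nonneg hj n2
        have := mul_nonneg hk n3
        have h3 : d i * (op (b i) (b i) ⬝ᵥ (Y *ᵥ op (b i) (b i))) = 0 := by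
          have := mul_nonneg h.le n1
          linarith
        exact (mul_eq_zero.1 h3).resolve_left hi
    have hli : LinearIndependent ℝ ![b i, b j] := by
      simpa using pair_indep hb hij 1 0 0 1 (by norm_num)
    exact good_of_sq hY hH h0 hli (psd_ker hY hz)

lemma mv_eq_zero {v : Fin 3 → ℝ} (h : mv v = 0) : v = 0 := by
  have h0 := congrFun h 0
  have h1 := congrFun h 1
  have h2 := congrFun h 2
  simp [mv] at h0 h1 h2
  ext i; fin_cases i <;> simp [h0, h1, h2]

lemma descent (G0 : Matrix (Fin 6) (Fin 6) ℝ) (hG : ∀ v : Fin 3 → ℝ, v ≠ 0 → 0 < mv v ⬝ᵥ (G0 *ᵥ mv v)) :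
    ∀ (n : ℕ) (Y : Matrix (Fin 6) (Fin 6) ℝ), Y.PosSemidef → Hank Y → Y ≠ 0 →
      6 ≤ Module.finrank ℝ (LinearMap.ker Y.mulVecLin) + n → 0 < ∑ i, ∑ j, Y i j * G0 i j := by
  intro n
  induction n with
  | zero =>
    intro Y hY hH h0 hn
    exfalso
    apply h0
    have h1 : LinearMap.ker Y.mulVecLin = ⊤ := by
      apply Submodule.eq_top_of_finrank_eq
      have := Submodule.finrank_le (LinearMap.ker Y.mulVecLin)
      simp at this ⊢
      omega
    have h2 : Y.mulVecLin = 0 := LinearMap.ker_eq_top.1 h1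
    ext i j
    have := congrFun (LinearMap.congr_fun h2 (Pi.single j 1)) i
    simpa using this
  | succ n ih =>
    intro Y hY hH h0 hn
    obtain ⟨v, hv, w, hw⟩ := good_all hY hH h0
    have hs : 0 < w ⬝ᵥ (Y *ᵥ w) := by
      refine lt_of_le_of_ne (psd_nonneg hY w) (fun h => ?_)
      have h1 := psd_ker hY h.symm
      rw [h1] at hw
      exact hv (mv_eq_zero hw.symm)
    set s := w ⬝ᵥ (Y *ᵥ w) with hsdef
    set u := Y *ᵥ w with hu
    set Y' := Y - (1 / s) • vecMulVec u u with hY'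
    have hmul : ∀ x, Y' *ᵥ x = Y *ᵥ x - (u ⬝ᵥ x / s) • u := by
      intro x
      ext i
      rw [hY', sub_mulVec, smul_mulVec, vecMulVec_mulVec]
      simp
      ring
    have hform : ∀ x, x ⬝ᵥ (Y' *ᵥ x) = (x - (u ⬝ᵥ x / s) • w) ⬝ᵥ (Y *ᵥ (x - (u ⬝ᵥ x / s) • w)) := by
      intro x
      rw [hmul]
      have e : w ⬝ᵥ (Y *ᵥ x) = x ⬝ᵥ u := bil_symm hY w x
      simp only [mulVec_sub, mulVec_smul, dotProduct_sub, sub_dotProduct, smul_dotProduct,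
        dotProduct_smul, smul_eq_mul, ← hu, ← hsdef, e, dotProduct_comm u x]
      field_simp
      ring
    have hpsd : Y'.PosSemidef := by
      apply PosSemidef.of_dotProduct_mulVec_nonneg
      · apply IsHermitian.sub hY.isHermitian
        ext i j
        simp [vecMulVec_apply]; ring_nf
        simp
      · intro x
        have := psd_nonneg hY (x - (u ⬝ᵥ x / s) • w)
        rw [← hform] at this
        simpa using this
    have hHank : Hank Y' := by
      obtain ⟨h1, h2, h3, h4, h5, h6⟩ := hH
      refine ⟨?_, ?_, ?_, ?_, ?_, ?_⟩ <;>
        simp [hY', vecMulVec_apply, hw, mv, h1, h2, h3, h4, h5, h6] <;> ring_nf <;> simp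
    have hsum : ∑ i, ∑ j, Y i j * G0 i j
        = ∑ i, ∑ j, Y' i j * G0 i j + (1 / s) * (mv v ⬝ᵥ (G0 *ᵥ mv v)) := by
      simp only [dotProduct, mulVec, Finset.mul_sum, ← Finset.sum_add_distrib]
      refine Finset.sum_congr rfl fun i _ => Finset.sum_congr rfl fun j _ => ?_
      rw [← hw]
      simp [hY', vecMulVec_apply]
      ring
    have hpos : 0 < (1 / s) * (mv v ⬝ᵥ (G0 *ᵥ mv v)) := mul_pos (by positivity) (hG v hv)
    rw [hsum]
    by_cases hz : Y' = 0
    · rw [hz]; simpa using hpos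
    · refine add_pos (ih Y' hpsd hHank hz ?_) hpos
      have hlt : LinearMap.ker Y.mulVecLin < LinearMap.ker Y'.mulVecLin := by
        refine lt_of_le_of_ne ?_ ?_
        · intro x hx
          have hx' : Y *ᵥ x = 0 := by simpa using hx
          have : u ⬝ᵥ x = 0 := by
            rw [hu, dotProduct_comm, bil_symm hY, hx', dotProduct_zero]
          simp [hmul, hx', this]
        · intro h
          have : w ∈ LinearMap.ker Y'.mulVecLin := by
            simp only [LinearMap.mem_ker, mulVecLin_apply, hmul]
            rw [dotProduct_comm, ← hsdef, div_self hs.ne', one_smul, sub_self]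
          rw [← h] at this
          simp only [LinearMap.mem_ker, mulVecLin_apply, ← hu] at this
          rw [this] at hw
          exact hv (mv_eq_zero hw.symm)
      have := Submodule.finrank_lt_finrank_of_lt hlt
      omega

/-- the matrices with zero Gram form -/
noncomputable def MM (m : Matrix (Fin 3) (Fin 3) ℝ) : Matrix (Fin 6) (Fin 6) ℝ :=
  !![0, m 2 2 / 2, m 1 1 / 2, 0, 0, -m 1 2;
     m 2 2 / 2, 0, m 0 0 / 2, 0, -m 0 2, 0;
     m 1 1 / 2, m 0 0 / 2, 0, -m 0 1, 0, 0;
     0, 0, -m 0 1, -m 2 2, m 1 2, m 0 2;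
     0, -m 0 2, 0, m 1 2, -m 1 1, m 0 1;
     -m 1 2, 0, 0, m 0 2, m 0 1, -m 0 0]

/-- the coordinates of a Gram matrix -/
def mu (G : Matrix (Fin 6) (Fin 6) ℝ) : Matrix (Fin 3) (Fin 3) ℝ :=
  !![-G 5 5, G 4 5, G 3 5; G 4 5, -G 4 4, G 3 4; G 3 5, G 3 4, -G 3 3]

lemma mu_symm (G) : (mu G)ᵀ = mu G := by
  ext i j; fin_cases i <;> fin_cases j <;> simp [mu]

lemma MM_symm (m) : (MM m)ᵀ = MM m := by
  ext i j; fin_cases i <;> fin_cases j <;> simp [MM]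

lemma MM_add (m n) : MM (m + n) = MM m + MM n := by
  ext i j; fin_cases i <;> fin_cases j <;> simp [MM] <;> ring

lemma MM_smul (c : ℝ) (m) : MM (c • m) = c • MM m := by
  ext i j; fin_cases i <;> fin_cases j <;> simp [MM] <;> ring

lemma MM_sub (m n) : MM (m - n) = MM m - MM n := by
  ext i j; fin_cases i <;> fin_cases j <;> simp [MM] <;> ring

lemma mu_add (m n) : mu (m + n) = mu m + mu n := by
  ext i j; fin_cases i <;> fin_cases j <;> simp [mu] <;> ring

lemma mu_smul (c : ℝ) (m) : mu (c • m) = c • mu m := by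
  ext i j; fin_cases i <;> fin_cases j <;> simp [mu]

lemma mu_sub (m n) : mu (m - n) = mu m - mu n := by
  ext i j; fin_cases i <;> fin_cases j <;> simp [mu] <;> ring

lemma mu_MM (m) (hm : mᵀ = m) : mu (MM m) = m := by
  have h : ∀ i j, m i j = m j i := fun i j => congrFun (congrFun hm j) i
  ext i j; fin_cases i <;> fin_cases j <;> simp [mu, MM] <;> exact h _ _

lemma MM_form (m) (hm : mᵀ = m) (a : Fin 6 → ℝ) :
    a ⬝ᵥ (MM m *ᵥ a) = (m * (sm a).adjugate).trace := by
  have h : ∀ i j, m i j = m j i := fun i j => congrFun (congrFun hm j) i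
  rw [adjugate_fin_three, trace_fin_three]
  simp [MM, sm, dotProduct, mulVec, Fin.sum_univ_succ, Matrix.mul_apply]
  rw [h 1 0, h 2 0, h 2 1]
  ring

lemma MM_mv (m) (v : Fin 3 → ℝ) : mv v ⬝ᵥ (MM m *ᵥ mv v) = 0 := by
  simp [MM, mv, dotProduct, mulVec, Fin.sum_univ_succ]
  ring

/-- the quartic of a Gram matrix -/
noncomputable def gp (G : Matrix (Fin 6) (Fin 6) ℝ) : MvPolynomial (Fin 3) ℝ :=
  ∑ i, ∑ j, MvPolynomial.C (G i j) * (gramBasis i * gramBasis j)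

lemma eval_gramBasis (v : Fin 3 → ℝ) (i : Fin 6) : eval v (gramBasis i) = mv v i := by
  fin_cases i <;> simp [gramBasis, mv, pow_two]

lemma eval_gp (v : Fin 3 → ℝ) (G) : eval v (gp G) = mv v ⬝ᵥ (G *ᵥ mv v) := by
  simp only [gp, map_sum, map_mul, eval_C, eval_gramBasis, dotProduct, mulVec, Finset.mul_sum]
  refine Finset.sum_congr rfl fun i _ => Finset.sum_congr rfl fun j _ => ?_
  ring

lemma mem_gram {f : MvPolynomial (Fin 3) ℝ} {G} : G ∈ GramSpectrahedron f ↔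
    G.PosSemidef ∧ ∀ v, mv v ⬝ᵥ (G *ᵥ mv v) = eval v f := by
  constructor
  · rintro ⟨h1, h2⟩
    refine ⟨h1, fun v => ?_⟩
    rw [← eval_gp, ← h2]; rfl
  · rintro ⟨h1, h2⟩
    refine ⟨h1, ?_⟩
    apply MvPolynomial.funext
    intro v
    rw [← h2, ← eval_gp]; rfl

lemma basis_prod (a b c : ℕ) (h : a + b + c = 4) :
    ∃ i j, gramBasis i * gramBasis j = X 0 ^ a * X 1 ^ b * X 2 ^ c := by
  have ha : a ≤ 4 := by omega
  have hb : b ≤ 4 := by omega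
  have hc : c = 4 - a - b := by omega
  subst hc
  have key : ∀ (i j : Fin 6) (p : MvPolynomial (Fin 3) ℝ), gramBasis i * gramBasis j = p →
    ∃ i j, gramBasis i * gramBasis j = p := fun i j p h => ⟨i, j, h⟩
  interval_cases a
  · interval_cases b
    · exact key 2 2 _ (by simp [gramBasis]; ring)
    · exact key 2 5 _ (by simp [gramBasis]; ring)
    · exact key 1 2 _ (by simp [gramBasis])
    · exact key 1 5 _ (by simp [gramBasis]; ring)
    · exact key 1 1 _ (by simp [gramBasis]; ring)
  · interval_cases b
    · exact key 2 4 _ (by simp [gramBasis]; ring)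
    · exact key 2 3 _ (by simp [gramBasis]; ring)
    · exact key 1 4 _ (by simp [gramBasis]; ring)
    · exact key 1 3 _ (by simp [gramBasis]; ring)
    · omega
  · interval_cases b
    · exact key 0 2 _ (by simp [gramBasis])
    · exact key 0 5 _ (by simp [gramBasis]; ring)
    · exact key 0 1 _ (by simp [gramBasis])
    · omega
    · omega
  · interval_cases b
    · exact key 0 4 _ (by simp [gramBasis]; ring)
    · exact key 0 3 _ (by simp [gramBasis]; ring)
    all_goals omega
  · interval_cases b
    · exact key 0 0 _ (by simp [gramBasis]; ring)
    all_goals omega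

lemma gp_add (G H) : gp (G + H) = gp G + gp H := by
  simp [gp, add_mul, Finset.sum_add_distrib]

lemma exists_gp (f : MvPolynomial (Fin 3) ℝ) (hhom : f.IsHomogeneous 4) : ∃ G, gp G = f := by
  classical
  have mono : ∀ s ∈ f.support, ∃ G, gp G = monomial s (coeff s f) := by
    intro s hs
    have h4 := hhom (mem_support_iff.1 hs)
    rw [show Finsupp.weight (1 : Fin 3 → ℕ) = _ from Finsupp.degree_eq_weight_one.symm, Finsupp.degree_eq_sum] at h4
    simp only [Fin.sum_univ_three] at h4
    obtain ⟨i, j, hij⟩ := basis_prod _ _ _ h4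
    refine ⟨Matrix.single i j (coeff s f), ?_⟩
    rw [monomial_eq, Finsupp.prod_fintype _ _ (by simp), Fin.prod_univ_three, ← hij, gp]
    rw [Finset.sum_eq_single i, Finset.sum_eq_single j]
    · simp
    · intro b _ hb; simp [Matrix.single_apply, hb.symm]
    · simp
    · intro b _ hb; apply Finset.sum_eq_zero; intro c _; simp [Matrix.single_apply, hb.symm]
    · simp
  have : ∀ t : Finset (Fin 3 →₀ ℕ), t ⊆ f.support → ∃ G, gp G = ∑ s ∈ t, monomial s (coeff s f) := by
    intro t
    induction t using Finset.induction_on with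
    | empty => intro _; exact ⟨0, by simp [gp]⟩
    | insert s t hst ih =>
      intro h
      obtain ⟨G1, h1⟩ := ih (fun x hx => h (Finset.mem_insert_of_mem hx))
      obtain ⟨G2, h2⟩ := mono s (h (Finset.mem_insert_self _ _))
      exact ⟨G2 + G1, by rw [gp_add, h1, h2, Finset.sum_insert hst]⟩
  obtain ⟨G, hG⟩ := this f.support subset_rfl
  exact ⟨G, by rw [hG]; exact f.support_sum_monomial_coeff⟩

lemma exists_gram (f : MvPolynomial (Fin 3) ℝ) (hhom : f.IsHomogeneous 4) :
    ∃ G, Gᵀ = G ∧ ∀ v, mv v ⬝ᵥ (G *ᵥ mv v) = eval v f := by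
  obtain ⟨G, hG⟩ := exists_gp f hhom
  refine ⟨(1 / 2 : ℝ) • (G + Gᵀ), ?_, ?_⟩
  · rw [transpose_smul, transpose_add, transpose_transpose, add_comm]
  · intro v
    rw [smul_mulVec, add_mulVec, dotProduct_smul, dotProduct_add, mulVec_transpose,
      dotProduct_comm (mv v) (mv v ᵥ* G), ← dotProduct_mulVec, ← eval_gp, hG, smul_eq_mul]
    ring

lemma gram_diff {G : Matrix (Fin 6) (Fin 6) ℝ} (hs : Gᵀ = G)
    (h : ∀ v, mv v ⬝ᵥ (G *ᵥ mv v) = 0) : G = MM (mu G) := by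
  have hs : ∀ i j, G i j = G j i := fun i j => congrFun (congrFun hs j) i
  have key : ∀ x y z : ℝ, G 0 0 * x ^ 4 + G 1 1 * y ^ 4 + G 2 2 * z ^ 4 + 2 * G 0 3 * x ^ 3 * y
      + 2 * G 0 4 * x ^ 3 * z + 2 * G 1 3 * y ^ 3 * x + 2 * G 1 5 * y ^ 3 * z
      + 2 * G 2 4 * z ^ 3 * x + 2 * G 2 5 * z ^ 3 * y + (2 * G 0 1 + G 3 3) * x ^ 2 * y ^ 2
      + (2 * G 0 2 + G 4 4) * x ^ 2 * z ^ 2 + (2 * G 1 2 + G 5 5) * y ^ 2 * z ^ 2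
      + 2 * (G 0 5 + G 3 4) * x ^ 2 * y * z + 2 * (G 1 4 + G 3 5) * x * y ^ 2 * z
      + 2 * (G 2 3 + G 4 5) * x * y * z ^ 2 = 0 := by
    intro x y z
    rw [← h ![x, y, z]]
    simp only [mv, dotProduct, mulVec, Fin.sum_univ_six, Matrix.cons_val]
    rw [hs 1 0, hs 2 0, hs 3 0, hs 4 0, hs 5 0, hs 2 1, hs 3 1, hs 4 1, hs 5 1, hs 3 2, hs 4 2,
      hs 5 2, hs 4 3, hs 5 3, hs 5 4]
    ring
  have k1 := key 1 0 0
  have k2 := key 0 1 0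
  have k3 := key 0 0 1
  have a1 := key 1 1 0
  have a2 := key 1 (-1) 0
  have a3 := key 2 1 0
  have b1 := key 1 0 1
  have b2 := key 1 0 (-1)
  have b3 := key 2 0 1
  have c1 := key 0 1 1
  have c2 := key 0 1 (-1)
  have c3 := key 0 2 1
  have d1 := key 1 1 1
  have d2 := key 1 1 (-1)
  have d3 := key 1 (-1) 1
  norm_num at k1 k2 k3 a1 a2 a3 b1 b2 b3 c1 c2 c3 d1 d2 d3
  have e03 : G 0 3 = 0 := by linarith
  have e13 : G 1 3 = 0 := by linarith
  have e33 : 2 * G 0 1 + G 3 3 = 0 := by linarith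
  have e04 : G 0 4 = 0 := by linarith
  have e24 : G 2 4 = 0 := by linarith
  have e44 : 2 * G 0 2 + G 4 4 = 0 := by linarith
  have e15 : G 1 5 = 0 := by linarith
  have e25 : G 2 5 = 0 := by linarith
  have e55 : 2 * G 1 2 + G 5 5 = 0 := by linarith
  rw [k1, k2, k3, e03, e13, e33, e04, e24, e44, e15, e25, e55] at d1 d2 d3
  have e05 : G 0 5 + G 3 4 = 0 := by linarith
  have e14 : G 1 4 + G 3 5 = 0 := by linarith
  have e23 : G 2 3 + G 4 5 = 0 := by linarith
  have hup : ∀ i j, i ≤ j → G i j = MM (mu G) i j := by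
    intro i j hij
    fin_cases i <;> fin_cases j <;> first
      | exact absurd hij (by decide)
      | (simp [MM, mu]; linarith)
      | (simp [MM, mu])
  ext i j
  rcases le_total i j with h' | h'
  · exact hup i j h'
  · rw [hs i j, hup j i h']
    exact congrFun (congrFun (MM_symm (mu G)) i) j

/-- directional derivative of the Veronese map -/
def dm {R : Type*} [CommRing R] (e v : Fin 3 → R) : Fin 6 → R :=
  ![2 * e 0 * v 0, 2 * e 1 * v 1, 2 * e 2 * v 2, e 0 * v 1 + e 1 * v 0, e 0 * v 2 + e 2 * v 0,
    e 1 * v 2 + e 2 * v 1]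

lemma mv_add {R : Type*} [CommRing R] (v e : Fin 3 → R) (t : R) :
    mv (v + t • e) = mv v + t • dm e v + t ^ 2 • mv e := by
  ext i; fin_cases i <;> simp [mv, dm] <;> ring

lemma ceval_basis (a : Fin 3 → ℂ) (k : Fin 6) :
    eval a (map (algebraMap ℝ ℂ) (gramBasis k)) = mv a k := by
  fin_cases k <;> simp [gramBasis, mv, pow_two]

lemma ceval_dbasis (a : Fin 3 → ℂ) (i : Fin 3) (k : Fin 6) :
    eval a (pderiv i (map (algebraMap ℝ ℂ) (gramBasis k))) = dm (Pi.single i 1) a k := by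
  fin_cases i <;> fin_cases k <;> simp [gramBasis, dm, pderiv_X, Pi.single_apply, Derivation.leibniz]

lemma grad_gp (a : Fin 3 → ℂ) (i : Fin 3) (G) :
    eval a (pderiv i (map (algebraMap ℝ ℂ) (gp G)))
      = dm (Pi.single i 1) a ⬝ᵥ (G.map (algebraMap ℝ ℂ) *ᵥ mv a)
        + mv a ⬝ᵥ (G.map (algebraMap ℝ ℂ) *ᵥ dm (Pi.single i 1) a) := by
  simp only [gp, map_sum, map_mul, map_C, pderiv_mul, pderiv_C, map_add, zero_mul,
    eval_C, ceval_basis, ceval_dbasis, dotProduct, mulVec, Finset.mul_sum,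
    ← Finset.sum_add_distrib, Matrix.map_apply]
  refine Finset.sum_congr rfl fun i _ => Finset.sum_congr rfl fun j _ => ?_
  simp
  ring

lemma sym_bil {R n : Type*} [CommRing R] [Fintype n] {G : Matrix n n R} (hs : Gᵀ = G) (p q : n → R) :
    p ⬝ᵥ (G *ᵥ q) = q ⬝ᵥ (G *ᵥ p) := by
  conv_lhs => rw [← hs]
  rw [dotProduct_mulVec, vecMul_transpose, dotProduct_comm]

lemma gp_eq {f : MvPolynomial (Fin 3) ℝ} {G} (h : ∀ v, mv v ⬝ᵥ (G *ᵥ mv v) = eval v f) : gp G = f := by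
  apply MvPolynomial.funext
  intro v
  rw [eval_gp, h]

/-- smoothness in terms of Gram matrices -/
lemma smooth_gram {f : MvPolynomial (Fin 3) ℝ} (hsm : IsSmooth f) {G} (hs : Gᵀ = G)
    (h : ∀ v, mv v ⬝ᵥ (G *ᵥ mv v) = eval v f) (a : Fin 3 → ℂ)
    (ha : ∀ i, dm (Pi.single i 1) a ⬝ᵥ (G.map (algebraMap ℝ ℂ) *ᵥ mv a) = 0) : a = 0 := by
  apply hsm
  intro i
  rw [← gp_eq h, grad_gp, sym_bil (p := mv a), ha]
  · simp
  · rw [← transpose_map, hs]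

lemma lin_zero (L M N P : ℝ) (h : ∀ t : ℝ, 0 ≤ t * L + t ^ 2 * M + t ^ 3 * N + t ^ 4 * P) : L = 0 := by
  have hd : HasDerivAt (fun t : ℝ => t * L + t ^ 2 * M + t ^ 3 * N + t ^ 4 * P) L 0 := by
    have h1 := ((((hasDerivAt_id (0:ℝ)).mul_const L).add (((hasDerivAt_id (0:ℝ)).pow 2).mul_const M)).add
      (((hasDerivAt_id (0:ℝ)).pow 3).mul_const N)).add (((hasDerivAt_id (0:ℝ)).pow 4).mul_const P)
    exact h1.congr_deriv (by simp)
  have hm : IsLocalMin (fun t : ℝ => t * L + t ^ 2 * M + t ^ 3 * N + t ^ 4 * P) 0 := by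
    apply Filter.Eventually.of_forall
    intro t
    simpa using h t
  exact hm.hasDerivAt_eq_zero hd

lemma pos_def {f : MvPolynomial (Fin 3) ℝ} (hsm : IsSmooth f) (hpsd : IsPsd f) {G} (hs : Gᵀ = G)
    (h : ∀ v, mv v ⬝ᵥ (G *ᵥ mv v) = eval v f) (v : Fin 3 → ℝ) (hv : v ≠ 0) :
    0 < mv v ⬝ᵥ (G *ᵥ mv v) := by
  refine lt_of_le_of_ne (by rw [h]; exact hpsd v) ?_
  intro h0
  apply hv
  have hL : ∀ e, dm e v ⬝ᵥ (G *ᵥ mv v) = 0 := by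
    intro e
    have := lin_zero (2 * (dm e v ⬝ᵥ (G *ᵥ mv v)))
      (dm e v ⬝ᵥ (G *ᵥ dm e v) + 2 * (mv e ⬝ᵥ (G *ᵥ mv v)))
      (2 * (mv e ⬝ᵥ (G *ᵥ dm e v))) (mv e ⬝ᵥ (G *ᵥ mv e)) (by
        intro t
        have h1 := hpsd (v + t • e)
        rw [← h, mv_add] at h1
        simp only [mulVec_add, mulVec_smul, dotProduct_add, add_dotProduct, smul_dotProduct,
          dotProduct_smul, smul_eq_mul, ← h0, sym_bil hs (mv v) (dm e v), sym_bil hs (mv v) (mv e),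
          sym_bil hs (dm e v) (mv e)] at h1
        linarith)
    linarith
  have := smooth_gram hsm hs h (fun i => (v i : ℂ)) (by
    intro i
    have h1 := congrArg (algebraMap ℝ ℂ) (hL (Pi.single i 1))
    rw [map_zero] at h1
    have e1 : (algebraMap ℝ ℂ) ∘ (G *ᵥ mv v) = G.map (algebraMap ℝ ℂ) *ᵥ ((algebraMap ℝ ℂ) ∘ mv v) := by
      ext k
      exact RingHom.map_mulVec _ _ _ _
    rw [← h1, RingHom.map_dotProduct, e1]
    congr 1
    · ext k; fin_cases i <;> fin_cases k <;> simp [dm, Pi.single_apply]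
    · congr 1
      ext k; fin_cases k <;> simp [mv])
  ext i
  have := congrFun this i
  simpa using this

/-- strictly positive definite -/
def Pos (X : Matrix (Fin 6) (Fin 6) ℝ) : Prop := ∀ a, a ≠ 0 → 0 < a ⬝ᵥ (X *ᵥ a)

lemma form_cont : Continuous fun z : Matrix (Fin 6) (Fin 6) ℝ × (Fin 6 → ℝ) => z.2 ⬝ᵥ (z.1 *ᵥ z.2) := by
  simp only [dotProduct, mulVec]
  fun_prop

lemma form_smul (X : Matrix (Fin 6) (Fin 6) ℝ) (a : Fin 6 → ℝ) (c : ℝ) :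
    (c • a) ⬝ᵥ (X *ᵥ (c • a)) = c ^ 2 * (a ⬝ᵥ (X *ᵥ a)) := by
  rw [mulVec_smul, dotProduct_smul, smul_dotProduct, smul_eq_mul, smul_eq_mul]; ring

lemma pos_iff {X : Matrix (Fin 6) (Fin 6) ℝ} :
    Pos X ↔ ∀ a ∈ Metric.sphere (0 : Fin 6 → ℝ) 1, 0 < a ⬝ᵥ (X *ᵥ a) := by
  constructor
  · intro h a ha
    apply h
    rintro rfl
    simp at ha
  · intro h a ha
    have hn : 0 < ‖a‖ := norm_pos_iff.2 ha
    have := h (‖a‖⁻¹ • a) (by simp [norm_smul, hn.ne'])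
    rw [form_smul] at this
    exact (pos_iff_pos_of_mul_pos this).1 (by positivity)

lemma isOpen_pos : IsOpen {X | Pos X} := by
  rw [isOpen_iff_mem_nhds]
  intro X hX
  have hX := pos_iff.1 hX
  have := (isCompact_sphere (0 : Fin 6 → ℝ) 1).eventually_forall_of_forall_eventually (x₀ := X)
    (P := fun X a => 0 < a ⬝ᵥ (X *ᵥ a)) (by
      intro a ha
      exact form_cont.continuousAt.eventually (lt_mem_nhds (hX a ha)))
  filter_upwards [this] with Z hZ
  exact pos_iff.2 hZ

lemma convex_pos : Convex ℝ {X | Pos X} := by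
  intro X hX Z hZ s t hs ht hst a ha
  rw [add_mulVec, smul_mulVec, smul_mulVec, dotProduct_add, dotProduct_smul, dotProduct_smul]
  have h1 := hX a ha
  have h2 := hZ a ha
  simp only [smul_eq_mul]
  rcases hs.eq_or_lt with rfl | h
  · have : t = 1 := by linarith
    subst this; simpa using h2
  · have := mul_pos h h1
    have := mul_nonneg ht h2.le
    linarith

lemma exists_pos (G0 : Matrix (Fin 6) (Fin 6) ℝ) (hs : G0ᵀ = G0)
    (hG : ∀ v : Fin 3 → ℝ, v ≠ 0 → 0 < mv v ⬝ᵥ (G0 *ᵥ mv v)) :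
    ∃ m : Matrix (Fin 3) (Fin 3) ℝ, mᵀ = m ∧ Pos (G0 + MM m) := by
  classical
  by_contra hcon
  push Not at hcon
  have hdisj : Disjoint {X | Pos X} {X | ∃ m : Matrix (Fin 3) (Fin 3) ℝ, mᵀ = m ∧ X = G0 + MM m} := by
    rw [Set.disjoint_left]
    rintro X hX ⟨m, hm, rfl⟩
    exact hcon m hm hX
  have hconv : Convex ℝ {X | ∃ m : Matrix (Fin 3) (Fin 3) ℝ, mᵀ = m ∧ X = G0 + MM m} := by
    rintro _ ⟨m, hm, rfl⟩ _ ⟨n, hn, rfl⟩ s t hs ht hst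
    refine ⟨s • m + t • n, by rw [transpose_add, transpose_smul, transpose_smul, hm, hn], ?_⟩
    rw [MM_add, MM_smul, MM_smul, smul_add, smul_add]
    have : G0 = s • G0 + t • G0 := by rw [← add_smul, hst, one_smul]
    nth_rw 3 [this]
    abel
  obtain ⟨φ, u, h1, h2⟩ := geometric_hahn_banach_open convex_pos isOpen_pos hconv hdisj
  set c : Fin 6 → Fin 6 → ℝ := fun i j => φ (Matrix.single i j 1) with hc
  have hφ : ∀ X, φ X = ∑ i, ∑ j, X i j * c i j := by
    intro X
    conv_lhs => rw [Matrix.matrix_eq_sum_single X]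
    simp only [map_sum]
    refine Finset.sum_congr rfl fun i _ => Finset.sum_congr rfl fun j _ => ?_
    have : Matrix.single i j (X i j) = X i j • Matrix.single i j (1 : ℝ) := by simp
    rw [this, map_smul, smul_eq_mul]
  have hone : Pos 1 := by
    intro a ha
    rw [one_mulVec]
    have : 0 ≤ a ⬝ᵥ a := by simpa using dotProduct_star_self_nonneg a
    exact lt_of_le_of_ne this (fun h => ha (dotProduct_self_eq_zero.1 h.symm))
  have hI : φ 1 < u := h1 1 hone
  have hu : 0 ≤ u := by
    by_contra hneg
    push Not at hneg
    have hpos : 0 < u / (2 * φ 1) := div_pos_of_neg_of_neg hneg (by linarith)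
    have := h1 ((u / (2 * φ 1)) • 1) (by
      intro a ha
      rw [smul_mulVec, dotProduct_smul]
      exact mul_pos hpos (hone a ha))
    rw [map_smul, smul_eq_mul] at this
    have hne : φ 1 ≠ 0 := by linarith
    have e : u / (2 * φ 1) * φ 1 = u / 2 := by field_simp
    linarith
  have hM : ∀ m : Matrix (Fin 3) (Fin 3) ℝ, mᵀ = m → φ (MM m) = 0 := by
    intro m hm
    by_contra hne
    have := h2 (G0 + MM (((u - φ G0 - 1) / φ (MM m)) • m)) ⟨_, by rw [transpose_smul, hm], rfl⟩
    rw [MM_smul, map_add, map_smul, smul_eq_mul, div_mul_cancel₀ _ hne] at this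
    linarith
  have hG0 : u ≤ φ G0 := h2 G0 ⟨0, by simp, by
    have : MM 0 = 0 := by have := MM_smul 0 0; simpa using this
    rw [this, add_zero]⟩
  set Y : Matrix (Fin 6) (Fin 6) ℝ := Matrix.of fun i j => -(c i j + c j i) / 2 with hY
  have hYφ : ∀ X : Matrix (Fin 6) (Fin 6) ℝ, Xᵀ = X → ∑ i, ∑ j, Y i j * X i j = - φ X := by
    intro X hX
    have hX' : ∀ i j, X i j = X j i := fun i j => congrFun (congrFun hX j) i
    have e1 : φ X = ∑ i, ∑ j, X i j * c j i := by
      rw [hφ, Finset.sum_comm]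
      refine Finset.sum_congr rfl fun i _ => Finset.sum_congr rfl fun j _ => ?_
      rw [hX']
    have e2 : - φ X = -(φ X + φ X) / 2 := by ring
    rw [e2]
    nth_rw 1 [e1]
    rw [hφ, ← Finset.sum_add_distrib]
    simp only [← Finset.sum_add_distrib, Finset.sum_div, ← Finset.sum_neg_distrib]
    refine Finset.sum_congr rfl fun i _ => Finset.sum_congr rfl fun j _ => ?_
    simp [hY]
    ring
  have hpsd : Y.PosSemidef := by
    apply PosSemidef.of_dotProduct_mulVec_nonneg
    · ext i j; simp [hY]; ring
    · intro x
      have e : star x ⬝ᵥ (Y *ᵥ x) = - φ (vecMulVec x x) := by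
        rw [← hYφ _ (by rw [transpose_vecMulVec])]
        simp only [dotProduct, mulVec, Finset.mul_sum, vecMulVec_apply, star_trivial]
        refine Finset.sum_congr rfl fun i _ => Finset.sum_congr rfl fun j _ => ?_
        ring
      rw [e]
      by_contra hneg
      push Not at hneg
      have hp : 0 < φ (vecMulVec x x) := by linarith
      have := h1 (((u - φ 1) / φ (vecMulVec x x)) • vecMulVec x x + 1) (by
        intro a ha
        rw [add_mulVec, smul_mulVec, dotProduct_add, dotProduct_smul, vecMulVec_mulVec]
        have h3 := hone a ha
        have h4 : 0 ≤ (u - φ 1) / φ (vecMulVec x x) := div_nonneg (by linarith) hp.le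
        have h5 : 0 ≤ a ⬝ᵥ (MulOpposite.op (x ⬝ᵥ a) • x) := by
          rw [dotProduct_smul, dotProduct_comm x a]
          simp
          exact mul_self_nonneg _
        have := mul_nonneg h4 h5
        rw [smul_eq_mul]; linarith)
      rw [map_add, map_smul, smul_eq_mul, div_mul_cancel₀ _ hp.ne'] at this
      linarith
  have hne : Y ≠ 0 := by
    intro h0
    have e1 := hYφ 1 (by simp)
    have e2 := hYφ G0 hs
    rw [h0] at e1 e2
    simp at e1 e2
    linarith
  have hYM : ∀ m : Matrix (Fin 3) (Fin 3) ℝ, mᵀ = m → ∑ i, ∑ j, Y i j * MM m i j = 0 := by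
    intro m hm
    rw [hYφ _ (MM_symm m), hM m hm, neg_zero]
  have hHank : Hank Y := by
    have hs' : ∀ i j, Y i j = Y j i := fun i j => by simp [hY]; ring
    have f1 := hYM !![0,0,0;0,0,0;0,0,1] (by ext i j; fin_cases i <;> fin_cases j <;> simp)
    have f2 := hYM !![0,0,0;0,1,0;0,0,0] (by ext i j; fin_cases i <;> fin_cases j <;> simp)
    have f3 := hYM !![1,0,0;0,0,0;0,0,0] (by ext i j; fin_cases i <;> fin_cases j <;> simp)
    have f4 := hYM !![0,1,0;1,0,0;0,0,0] (by ext i j; fin_cases i <;> fin_cases j <;> simp)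
    have f5 := hYM !![0,0,1;0,0,0;1,0,0] (by ext i j; fin_cases i <;> fin_cases j <;> simp)
    have f6 := hYM !![0,0,0;0,0,1;0,1,0] (by ext i j; fin_cases i <;> fin_cases j <;> simp)
    simp [MM, Fin.sum_univ_succ] at f1 f2 f3 f4 f5 f6
    have s1 := hs' 1 0
    have s2 := hs' 2 0
    have s3 := hs' 2 1
    have s4 := hs' 3 2
    have s5 := hs' 4 1
    have s6 := hs' 5 0
    have s7 := hs' 5 4
    have s8 := hs' 5 3
    have s9 := hs' 4 3
    refine ⟨?_, ?_, ?_, ?_, ?_, ?_⟩ <;> linarith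
  have := descent G0 hG 6 Y hpsd hHank hne (by omega)
  rw [hYφ G0 hs] at this
  linarith

lemma psd_symm {n : Type*} [Fintype n] {Y : Matrix n n ℝ} (hY : Y.PosSemidef) : Yᵀ = Y := by
  simpa using hY.isHermitian.eq

lemma psd_of {Y : Matrix (Fin 6) (Fin 6) ℝ} (hs : Yᵀ = Y) (h : ∀ a, 0 ≤ a ⬝ᵥ (Y *ᵥ a)) :
    Y.PosSemidef := by
  apply PosSemidef.of_dotProduct_mulVec_nonneg
  · simpa [IsHermitian] using hs
  · intro x; simpa using h x

lemma gram_sub {f : MvPolynomial (Fin 3) ℝ} {G H} (hG : G ∈ GramSpectrahedron f)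
    (hH : H ∈ GramSpectrahedron f) : H - G = MM (mu H - mu G) := by
  rw [mem_gram] at hG hH
  rw [← mu_sub]
  apply gram_diff
  · rw [transpose_sub, psd_symm hG.1, psd_symm hH.1]
  · intro v
    rw [sub_mulVec, dotProduct_sub, hG.2, hH.2, sub_self]

lemma gram_add {f : MvPolynomial (Fin 3) ℝ} {G} (hG : G ∈ GramSpectrahedron f) (m)
    (h : (G + MM m).PosSemidef) : G + MM m ∈ GramSpectrahedron f := by
  rw [mem_gram] at hG ⊢
  refine ⟨h, fun v => ?_⟩
  rw [add_mulVec, dotProduct_add, hG.2, MM_mv, add_zero]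

lemma perturb {G M : Matrix (Fin 6) (Fin 6) ℝ} (hG : G.PosSemidef) (hM : Mᵀ = M)
    (h : ∀ a, a ≠ 0 → G *ᵥ a = 0 → 0 < a ⬝ᵥ (M *ᵥ a)) :
    ∃ t : ℝ, 0 < t ∧ (G + t • M).PosSemidef := by
  have hc : Continuous fun z : ℝ × (Fin 6 → ℝ) => z.2 ⬝ᵥ ((G + z.1 • M) *ᵥ z.2) := by
    have h1 : Continuous fun z : ℝ × (Fin 6 → ℝ) => (G + z.1 • M, z.2) := by fun_prop
    exact form_cont.comp h1
  have hc2 : Continuous fun z : ℝ × (Fin 6 → ℝ) => z.2 ⬝ᵥ (M *ᵥ z.2) := by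
    have h1 : Continuous fun z : ℝ × (Fin 6 → ℝ) => (M, z.2) := by fun_prop
    exact form_cont.comp h1
  have key := (isCompact_sphere (0 : Fin 6 → ℝ) 1).eventually_forall_of_forall_eventually (x₀ := (0:ℝ))
    (P := fun t a => 0 ≤ t → 0 ≤ a ⬝ᵥ ((G + t • M) *ᵥ a)) (by
      intro a ha
      have ha0 : a ≠ 0 := by rintro rfl; simp at ha
      by_cases hk : G *ᵥ a = 0
      · have h1 := (hc2.continuousAt (x := ((0:ℝ), a))).eventually (lt_mem_nhds (h a ha0 hk))
        filter_upwards [h1] with z hz ht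
        rw [add_mulVec, smul_mulVec, dotProduct_add, dotProduct_smul, smul_eq_mul]
        have := psd_nonneg hG z.2
        have := mul_nonneg ht hz.le
        linarith
      · have h0 : 0 < a ⬝ᵥ (G *ᵥ a) :=
          lt_of_le_of_ne (psd_nonneg hG a) (fun h' => hk (psd_ker hG h'.symm))
        have h1 := (hc.continuousAt (x := ((0:ℝ), a))).eventually (lt_mem_nhds (a := 0) (by simpa using h0))
        filter_upwards [h1] with z hz ht
        exact hz.le)
  obtain ⟨ε, hε, hball⟩ := Metric.eventually_nhds_iff.1 key
  refine ⟨ε / 2, by linarith, psd_of ?_ ?_⟩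
  · rw [transpose_add, transpose_smul, psd_symm hG, hM]
  · intro a
    by_cases ha : a = 0
    · simp [ha]
    · have hn : 0 < ‖a‖ := norm_pos_iff.2 ha
      have := hball (y := ε / 2) (by rw [Real.dist_eq, sub_zero, abs_of_pos (by linarith)]; linarith)
        (‖a‖⁻¹ • a) (by simp [norm_smul, hn.ne']) (by linarith)
      rw [form_smul] at this
      exact nonneg_of_mul_nonneg_right this (by positivity)

/-- minimizers of a linear functional on the Gram spectrahedron -/
def IsMn (f : MvPolynomial (Fin 3) ℝ) (N : Matrix (Fin 3) (Fin 3) ℝ) (G : Matrix (Fin 6) (Fin 6) ℝ) :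
    Prop := G ∈ GramSpectrahedron f ∧ ∀ H ∈ GramSpectrahedron f, (mu G * N).trace ≤ (mu H * N).trace

lemma kkt {f N G} (hG : IsMn f N G) {m} (hm : mᵀ = m)
    (h : ∀ a, a ≠ 0 → G *ᵥ a = 0 → 0 < a ⬝ᵥ (MM m *ᵥ a)) : 0 ≤ (m * N).trace := by
  obtain ⟨t, ht, hp⟩ := perturb hG.1.1 (MM_symm m) h
  rw [← MM_smul] at hp
  have := hG.2 _ (gram_add hG.1 _ hp)
  rw [mu_add, mu_MM _ (by rw [transpose_smul, hm]), add_mul, trace_add, smul_mul, trace_smul,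
    smul_eq_mul] at this
  exact nonneg_of_mul_nonneg_right (by linarith) ht

lemma gram_pos {f G Gs} (hG : G ∈ GramSpectrahedron f) (hGs : Gs ∈ GramSpectrahedron f) (hp : Pos Gs)
    (a) (h0 : a ≠ 0) (h : G *ᵥ a = 0) : 0 < a ⬝ᵥ (MM (mu Gs - mu G) *ᵥ a) := by
  rw [← gram_sub hG hGs, sub_mulVec, h, sub_zero]
  exact hp a h0

lemma mu_sub_symm (G H) : (mu G - mu H)ᵀ = mu G - mu H := by
  rw [transpose_sub, mu_symm, mu_symm]

lemma kkt_lin {f N G Gs} (hG : IsMn f N G) (hGs : Gs ∈ GramSpectrahedron f) (hp : Pos Gs) {r} (hr : rᵀ = r)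
    (h : ∀ a, G *ᵥ a = 0 → a ⬝ᵥ (MM r *ᵥ a) = 0) : (r * N).trace = 0 := by
  have key : ∀ s : ℝ, 0 ≤ ((mu Gs - mu G) * N).trace + s * (r * N).trace := by
    intro s
    have := kkt hG (m := mu Gs - mu G + s • r) (by rw [transpose_add, transpose_smul, hr, mu_sub_symm]) (by
      intro a ha hk
      rw [MM_add, MM_smul, add_mulVec, smul_mulVec, dotProduct_add, dotProduct_smul, h a hk, smul_zero,
        add_zero]
      exact gram_pos hG.1 hGs hp a ha hk)
    rwa [add_mul, trace_add, smul_mul, trace_smul, smul_eq_mul] at this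
  by_contra hne
  have := key ((-((mu Gs - mu G) * N).trace - 1) / (r * N).trace)
  rw [div_mul_cancel₀ _ hne] at this
  linarith

lemma MM_ker {m : Matrix (Fin 3) (Fin 3) ℝ} (hm : mᵀ = m) {a : Fin 6 → ℝ} (h : MM m *ᵥ a = 0) :
    m * (sm a).adjugate = 0 := by
  have hs : ∀ i j, m i j = m j i := fun i j => congrFun (congrFun hm j) i
  have h0 := congrFun h 0
  have h1 := congrFun h 1
  have h2 := congrFun h 2
  have h3 := congrFun h 3
  have h4 := congrFun h 4
  have h5 := congrFun h 5
  simp [MM, mulVec, dotProduct, Fin.sum_univ_succ] at h0 h1 h2 h3 h4 h5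
  have s1 := hs 1 0
  have s2 := hs 2 0
  have s3 := hs 2 1
  rw [adjugate_fin_three]
  ext i j
  fin_cases i <;> fin_cases j <;> simp [sm, Matrix.mul_apply, Fin.sum_univ_succ, s1, s2, s3]
  · linear_combination a 1 * h1 + a 2 * h2 + a 5 * h5 - a 0 * h0
  · linear_combination -2*a 3 * h1 - a 0 * h3 - a 4 * h5
  · linear_combination -2*a 4 * h2 - a 0 * h4 - a 3 * h5
  · linear_combination -2*a 3 * h0 - a 1 * h3 - a 5 * h4
  · linear_combination a 0 * h0 + a 2 * h2 + a 4 * h4 - a 1 * h1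
  · linear_combination -2*a 5 * h2 - a 1 * h5 - a 3 * h4
  · linear_combination -2*a 4 * h0 - a 2 * h4 - a 5 * h3
  · linear_combination -2*a 5 * h1 - a 2 * h5 - a 4 * h3
  · linear_combination a 0 * h0 + a 1 * h1 + a 3 * h3 - a 2 * h2

lemma trace_sq_zero {A : Matrix (Fin 3) (Fin 3) ℝ} (h : (Aᵀ * A).trace = 0) : A = 0 := by
  rw [← conjTranspose_eq_transpose_of_trivial] at h
  exact trace_conjTranspose_mul_self_eq_zero_iff.1 h

lemma sm_symm {R : Type*} (a : Fin 6 → R) : (sm a)ᵀ = sm a := by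
  ext i j; fin_cases i <;> fin_cases j <;> rfl

lemma ker_rigid {f N G Gs} (hG : IsMn f N G) (hGs : Gs ∈ GramSpectrahedron f) (hp : Pos Gs)
    (hN : Nᵀ = N) (hdet : N.det ≠ 0) {m} (hm : mᵀ = m)
    (h : ∀ a, G *ᵥ a = 0 → MM m *ᵥ a = 0) : m = 0 := by
  have hz : (m * N) = 0 := by
    apply trace_sq_zero
    set E := (m * N)ᵀ with hE
    have hr : (E * m + m * Eᵀ)ᵀ = E * m + m * Eᵀ := by
      rw [transpose_add, transpose_mul, transpose_mul, transpose_transpose, hm, add_comm]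
    have := kkt_lin hG hGs hp hr (by
      intro a ha
      rw [MM_form _ hr]
      have h1 := MM_ker hm (h a ha)
      have h2 : (sm a).adjugate * m = 0 := by
        have := congrArg transpose h1
        rwa [transpose_mul, hm, adjugate_transpose, sm_symm, transpose_zero] at this
      have e2 : (m * Eᵀ * (sm a).adjugate).trace = 0 := by
        rw [Matrix.mul_assoc, trace_mul_comm, Matrix.mul_assoc, h2, Matrix.mul_zero, trace_zero]
      rw [add_mul, trace_add, Matrix.mul_assoc, h1, e2]
      simp)
    have e : (m * Eᵀ * N).trace = (E * m * N).trace := by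
      rw [← trace_transpose, transpose_mul, transpose_mul, hN, hm, transpose_transpose, trace_mul_comm]
    rw [add_mul, trace_add, e, Matrix.mul_assoc] at this
    linarith
  have : m * N * N⁻¹ = 0 := by rw [hz, Matrix.zero_mul]
  rwa [Matrix.mul_assoc, Matrix.mul_nonsing_inv _ (by simpa using hdet), Matrix.mul_one] at this

lemma min_extreme {f N G Gs} (hG : IsMn f N G) (hGs : Gs ∈ GramSpectrahedron f) (hp : Pos Gs)
    (hN : Nᵀ = N) (hdet : N.det ≠ 0) : G ∈ Set.extremePoints ℝ (GramSpectrahedron f) := by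
  refine ⟨hG.1, ?_⟩
  rintro x hx y hy ⟨s, t, hs, ht, hst, hxy⟩
  have h1 := ker_rigid hG hGs hp hN hdet (mu_sub_symm x G) (by
    intro a ha
    have hxa : x *ᵥ a = 0 := by
      apply psd_ker hx.1
      have h0 : a ⬝ᵥ (G *ᵥ a) = 0 := by rw [ha, dotProduct_zero]
      rw [← hxy, add_mulVec, smul_mulVec, smul_mulVec, dotProduct_add, dotProduct_smul,
        dotProduct_smul, smul_eq_mul, smul_eq_mul] at h0
      have p1 := psd_nonneg hx.1 a
      have p2 := mul_nonneg ht.le (psd_nonneg hy.1 a)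
      have p3 : s * (a ⬝ᵥ (x *ᵥ a)) = 0 := le_antisymm (by linarith) (mul_nonneg hs.le p1)
      exact (mul_eq_zero.1 p3).resolve_left hs.ne'
    rw [← gram_sub hG.1 hx, sub_mulVec, hxa, ha, sub_zero])
  have h2 := gram_sub hG.1 hx
  rw [h1] at h2
  have : MM 0 = 0 := by have := MM_smul 0 0; simpa using this
  rw [this] at h2
  exact sub_eq_zero.1 h2

lemma gram_convex (f : MvPolynomial (Fin 3) ℝ) : Convex ℝ (GramSpectrahedron f) := by
  intro x hx y hy s t hs ht hst
  rw [mem_gram] at *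
  refine ⟨(hx.1.smul hs).add (hy.1.smul ht), fun v => ?_⟩
  rw [add_mulVec, smul_mulVec, smul_mulVec, dotProduct_add, dotProduct_smul, dotProduct_smul, hx.2, hy.2,
    ← add_smul, hst, one_smul]

lemma min_unique {f N G H Gs} (hG : IsMn f N G) (hH : IsMn f N H) (hGs : Gs ∈ GramSpectrahedron f)
    (hp : Pos Gs) (hN : Nᵀ = N) (hdet : N.det ≠ 0) : G = H := by
  have e : (mu G * N).trace = (mu H * N).trace := le_antisymm (hG.2 _ hH.1) (hH.2 _ hG.1)
  have hmid : IsMn f N ((1/2 : ℝ) • G + (1/2 : ℝ) • H) := by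
    refine ⟨gram_convex f hG.1 hH.1 (by norm_num) (by norm_num) (by norm_num), fun K hK => ?_⟩
    rw [mu_add, mu_smul, mu_smul, add_mul, trace_add, smul_mul, smul_mul, trace_smul, trace_smul, ← e,
      ← add_smul]
    norm_num
    exact hG.2 K hK
  have hE := min_extreme hmid hGs hp hN hdet
  have h1 := hE.2 hG.1 hH.1 ⟨1/2, 1/2, by norm_num, by norm_num, by norm_num, rfl⟩
  have h2 : H = (1/2 : ℝ) • G + (1/2 : ℝ) • H :=
    hE.2 hH.1 hG.1 ⟨1/2, 1/2, by norm_num, by norm_num, by norm_num, by rw [add_comm]⟩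
  exact h1.trans h2.symm

lemma adj_smul_sm (c : ℝ) (a : Fin 6 → ℝ) : (sm (c • a)).adjugate = c ^ 2 • (sm a).adjugate := by
  rw [adjugate_fin_three, adjugate_fin_three]
  ext i j
  fin_cases i <;> fin_cases j <;> simp [sm] <;> ring

lemma min_ker_two {f N G Gs} (hG : IsMn f N G) (hGs : Gs ∈ GramSpectrahedron f)
    (hp : Pos Gs) (hN : Nᵀ = N) (hdet : N.det < 0) : 2 ≤ Module.finrank ℝ (LinearMap.ker G.mulVecLin) := by
  by_contra hcon
  have hf : Module.finrank ℝ (LinearMap.ker G.mulVecLin) ≤ 1 := by omega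
  obtain ⟨⟨a, ha⟩, hu⟩ := finrank_le_one_iff.1 hf
  have ha' : G *ᵥ a = 0 := by simpa using ha
  have hspan : ∀ b, G *ᵥ b = 0 → ∃ c : ℝ, b = c • a := by
    intro b hb
    obtain ⟨c, hc⟩ := hu ⟨b, by simpa using hb⟩
    exact ⟨c, (congrArg Subtype.val hc).symm⟩
  set P := (sm a).adjugate with hP
  have hPs : Pᵀ = P := by rw [hP, adjugate_transpose, sm_symm]
  set k := (N * P).trace / (P * P).trace with hk
  set m := N - k • P with hm
  have hms : mᵀ = m := by rw [hm, transpose_sub, transpose_smul, hN, hPs]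
  have e1 : (m * P).trace = 0 := by
    rw [hm, sub_mul, trace_sub, smul_mul, trace_smul, smul_eq_mul]
    by_cases h0 : (P * P).trace = 0
    · have : P = 0 := trace_sq_zero (by rw [hPs, h0])
      simp [this]
    · rw [hk, div_mul_cancel₀ _ h0, sub_self]
  have e2 : (m * N).trace = 0 := kkt_lin hG hGs hp hms (by
    intro b hb
    obtain ⟨c, rfl⟩ := hspan b hb
    rw [form_smul, MM_form _ hms, ← hP, e1, mul_zero])
  have e3 : m = 0 := by
    apply trace_sq_zero
    rw [hms]
    nth_rw 2 [hm]
    rw [mul_sub, trace_sub, Matrix.mul_smul, trace_smul, e1, e2]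
    simp
  have e4 : N = k • P := sub_eq_zero.1 e3
  have e5 : 0 ≤ k * (a ⬝ᵥ (MM (mu Gs - mu G) *ᵥ a)) := by
    have := kkt hG (mu_sub_symm Gs G) (gram_pos hG.1 hGs hp)
    rw [e4, Matrix.mul_smul, trace_smul, smul_eq_mul, hP, ← MM_form _ (mu_sub_symm Gs G)] at this
    exact this
  by_cases h0 : a = 0
  · have : P = 0 := by
      rw [hP, h0, adjugate_fin_three]
      ext i j
      fin_cases i <;> fin_cases j <;> simp [sm]
    rw [this, smul_zero] at e4
    rw [e4] at hdet
    simp at hdet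
  · have hk0 : 0 ≤ k := nonneg_of_mul_nonneg_left e5 (gram_pos hG.1 hGs hp a h0 ha')
    rw [e4, det_smul, hP, det_adjugate] at hdet
    simp at hdet
    have : 0 ≤ k ^ 3 * (sm a).det ^ 2 := by positivity
    linarith

lemma two_coord (K : Submodule ℂ (Fin 6 → ℂ)) (hK : Module.finrank ℂ K = 3) (i j : Fin 6) :
    (∃ C ∈ K, C ≠ 0 ∧ C i = 0 ∧ C j = 0) ∧
    ((∀ x ∈ K, ∀ y ∈ K, x i = 0 → x j = 0 → y i = 0 → y j = 0 →
      ∃ s t : ℂ, (s ≠ 0 ∨ t ≠ 0) ∧ s • x + t • y = 0) → ∀ u w, ∃ A ∈ K, A i = u ∧ A j = w) := by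
  let L : K →ₗ[ℂ] (Fin 2 → ℂ) :=
    { toFun := fun a => ![a.1 i, a.1 j]
      map_add' := by intro a b; ext k; fin_cases k <;> simp
      map_smul' := by intro a b; ext k; fin_cases k <;> simp }
  have hL : ∀ a, L a = ![a.1 i, a.1 j] := fun a => rfl
  have hmem : ∀ a : K, a ∈ LinearMap.ker L ↔ a.1 i = 0 ∧ a.1 j = 0 := by
    intro a
    rw [LinearMap.mem_ker, hL]
    constructor
    · intro h
      exact ⟨by simpa using congrFun h 0, by simpa using congrFun h 1⟩
    · rintro ⟨h1, h2⟩
      ext k; fin_cases k <;> simp [h1, h2]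
  constructor
  · have h1 : LinearMap.ker L ≠ ⊥ := LinearMap.ker_ne_bot_of_finrank_lt (by simp [hK])
    obtain ⟨x, hx, hx0⟩ := (Submodule.ne_bot_iff _).1 h1
    obtain ⟨h2, h3⟩ := (hmem x).1 hx
    exact ⟨x, x.2, by simpa using hx0, h2, h3⟩
  · intro hdep u w
    have hle : Module.finrank ℂ (LinearMap.ker L) ≤ 1 := by
      by_contra hcon
      push Not at hcon
      have : Nontrivial (LinearMap.ker L) := Module.nontrivial_of_finrank_pos (R := ℂ) (by omega)
      obtain ⟨x, hx⟩ := exists_ne (0 : LinearMap.ker L)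
      obtain ⟨y, hy⟩ :=
        exists_linearIndependent_pair_of_one_lt_finrank (R := ℂ) (M := LinearMap.ker L) hcon hx
      obtain ⟨s, t, hst, h⟩ := hdep x.1 x.1.2 y.1 y.1.2 ((hmem _).1 x.2).1 ((hmem _).1 x.2).2
        ((hmem _).1 y.2).1 ((hmem _).1 y.2).2
      have hy' := (LinearIndependent.pair_iff (R := ℂ) (M := LinearMap.ker L)).1 hy
      have := hy' s t (by ext1; ext1; simpa using h)
      rcases hst with h | h
      · exact h this.1
      · exact h this.2
    have hr := L.finrank_range_add_finrank_ker
    have hsurj : LinearMap.range L = ⊤ := by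
      apply Submodule.eq_top_of_finrank_eq
      have := Submodule.finrank_le (LinearMap.range L)
      simp at this ⊢
      omega
    obtain ⟨A, hA⟩ := LinearMap.range_eq_top.1 hsurj ![u, w]
    rw [hL] at hA
    exact ⟨A.1, A.2, by simpa using congrFun hA 0, by simpa using congrFun hA 1⟩

lemma rk1 (x y w : ℂ) (h : x * w = y ^ 2) : ∃ p r : ℂ, x = p * p ∧ y = p * r ∧ w = r * r := by
  by_cases hx : x = 0
  · obtain ⟨r, hr⟩ := IsAlgClosed.exists_eq_mul_self w
    refine ⟨0, r, by simpa using hx, ?_, hr⟩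
    rw [hx, zero_mul] at h
    simpa using h.symm
  · obtain ⟨p, hp⟩ := IsAlgClosed.exists_eq_mul_self x
    have hp0 : p ≠ 0 := by rintro rfl; simp at hp; exact hx hp
    refine ⟨p, y / p, hp, by field_simp, ?_⟩
    field_simp
    rw [← h, hp]; ring

lemma bin_root (a b c : ℂ) : ∃ s t : ℂ, (s ≠ 0 ∨ t ≠ 0) ∧ a * s ^ 2 + b * s * t + c * t ^ 2 = 0 := by
  by_cases ha : a = 0
  · exact ⟨1, 0, by simp, by simp [ha]⟩
  · obtain ⟨x, hx⟩ := exists_quadratic_eq_zero ha (b := b) (c := c) (IsAlgClosed.exists_eq_mul_self _)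
    exact ⟨x, 1, by simp, by linear_combination hx⟩

/-- no rank one element -/
def NoV (K : Submodule ℂ (Fin 6 → ℂ)) : Prop := ∀ z : Fin 3 → ℂ, mv z ∈ K → z = 0

lemma rankA {K : Submodule ℂ (Fin 6 → ℂ)} (hK : NoV K) {C} (hC : C ∈ K) (h2 : C 2 = 0) (h4 : C 4 = 0)
    (h5 : C 5 = 0) (h : C 0 * C 1 = C 3 ^ 2) : C = 0 := by
  obtain ⟨p, r, e1, e2, e3⟩ := rk1 _ _ _ h
  have : C = mv ![p, r, 0] := by
    ext k; fin_cases k <;> simp [mv, e1, e2, e3, h2, h4, h5]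
  rw [this] at hC
  rw [this, hK _ hC, mv_zero]

lemma rankB {K : Submodule ℂ (Fin 6 → ℂ)} (hK : NoV K) {C} (hC : C ∈ K) (h1 : C 1 = 0) (h3 : C 3 = 0)
    (h5 : C 5 = 0) (h : C 0 * C 2 = C 4 ^ 2) : C = 0 := by
  obtain ⟨p, r, e1, e2, e3⟩ := rk1 _ _ _ h
  have : C = mv ![p, 0, r] := by
    ext k; fin_cases k <;> simp [mv, e1, e2, e3, h1, h3, h5]
  rw [this] at hC
  rw [this, hK _ hC, mv_zero]

lemma depA {K : Submodule ℂ (Fin 6 → ℂ)} (hK : NoV K) {x y} (hx : x ∈ K) (hy : y ∈ K)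
    (hx2 : x 2 = 0) (hx4 : x 4 = 0) (hx5 : x 5 = 0) (hy2 : y 2 = 0) (hy4 : y 4 = 0) (hy5 : y 5 = 0) :
    ∃ s t : ℂ, (s ≠ 0 ∨ t ≠ 0) ∧ s • x + t • y = 0 := by
  obtain ⟨s, t, hst, h⟩ := bin_root (x 0 * x 1 - x 3 ^ 2) (x 0 * y 1 + y 0 * x 1 - 2 * x 3 * y 3)
    (y 0 * y 1 - y 3 ^ 2)
  refine ⟨s, t, hst, rankA hK (K.add_mem (K.smul_mem _ hx) (K.smul_mem _ hy)) ?_ ?_ ?_ ?_⟩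
  · simp [*]
  · simp [*]
  · simp [*]
  · simp only [Pi.add_apply, Pi.smul_apply, smul_eq_mul]
    linear_combination h

lemma depB {K : Submodule ℂ (Fin 6 → ℂ)} (hK : NoV K) {x y} (hx : x ∈ K) (hy : y ∈ K)
    (hx1 : x 1 = 0) (hx3 : x 3 = 0) (hx5 : x 5 = 0) (hy1 : y 1 = 0) (hy3 : y 3 = 0) (hy5 : y 5 = 0) :
    ∃ s t : ℂ, (s ≠ 0 ∨ t ≠ 0) ∧ s • x + t • y = 0 := by
  obtain ⟨s, t, hst, h⟩ := bin_root (x 0 * x 2 - x 4 ^ 2) (x 0 * y 2 + y 0 * x 2 - 2 * x 4 * y 4)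
    (y 0 * y 2 - y 4 ^ 2)
  refine ⟨s, t, hst, rankB hK (K.add_mem (K.smul_mem _ hx) (K.smul_mem _ hy)) ?_ ?_ ?_ ?_⟩
  · simp [*]
  · simp [*]
  · simp [*]
  · simp only [Pi.add_apply, Pi.smul_apply, smul_eq_mul]
    linear_combination h

/-- the quadratic form attached to a matrix -/
def qf (m : Matrix (Fin 3) (Fin 3) ℂ) (a : Fin 6 → ℂ) : ℂ := (m * (sm a).adjugate).trace

lemma qf_expand {m : Matrix (Fin 3) (Fin 3) ℂ} (hm : mᵀ = m) (a) : qf m a =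
    m 0 0 * (a 1 * a 2 - a 5 ^ 2) + m 1 1 * (a 0 * a 2 - a 4 ^ 2) + m 2 2 * (a 0 * a 1 - a 3 ^ 2)
    + 2 * m 0 1 * (a 4 * a 5 - a 3 * a 2) + 2 * m 0 2 * (a 3 * a 5 - a 1 * a 4)
    + 2 * m 1 2 * (a 3 * a 4 - a 0 * a 5) := by
  have h : ∀ i j, m i j = m j i := fun i j => congrFun (congrFun hm j) i
  rw [qf, adjugate_fin_three, trace_fin_three]
  simp [sm, Matrix.mul_apply, Fin.sum_univ_succ]
  rw [h 1 0, h 2 0, h 2 1]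
  ring

lemma sym_zero {m : Matrix (Fin 3) (Fin 3) ℂ} (hm : mᵀ = m) (h0 : m 0 0 = 0) (h1 : m 1 1 = 0)
    (h2 : m 2 2 = 0) (h3 : m 0 1 = 0) (h4 : m 0 2 = 0) (h5 : m 1 2 = 0) : m = 0 := by
  have h : ∀ i j, m i j = m j i := fun i j => congrFun (congrFun hm j) i
  have a1 := h 1 0
  have a2 := h 2 0
  have a3 := h 2 1
  ext i j; fin_cases i <;> fin_cases j <;> simp [*]

lemma core_sq {K : Submodule ℂ (Fin 6 → ℂ)} (hK3 : Module.finrank ℂ K = 3) (hK : NoV K)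
    {m : Matrix (Fin 3) (Fin 3) ℂ} (hm : mᵀ = m) (hq : ∀ a ∈ K, qf m a = 0) (h1 : ∀ a ∈ K, a 1 = 0) :
    m = 0 := by
  obtain ⟨⟨C, hC, hC0, hC3, hC5⟩, hsurj⟩ := two_coord K hK3 3 5
  have hs := hsurj (fun x hx y hy a b c d => depB hK hx hy (h1 x hx) a b (h1 y hy) c d)
  obtain ⟨F, hF, hF3, hF5⟩ := hs 1 0
  obtain ⟨H, hH, hH3, hH5⟩ := hs 0 1
  have hC1 := h1 C hC
  have hF1 := h1 F hF
  have hH1 := h1 H hH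
  have hdet : C 0 * C 2 - C 4 ^ 2 ≠ 0 := by
    intro h
    exact hC0 (rankB hK hC hC1 hC3 hC5 (by linear_combination h))
  have q1 := hq C hC
  have q2 := hq (C + F) (K.add_mem hC hF)
  have q3 := hq (C + H) (K.add_mem hC hH)
  have q4 := hq F hF
  have q5 := hq H hH
  have q6 := hq (F + H) (K.add_mem hF hH)
  rw [qf_expand hm] at q1 q2 q3 q4 q5 q6
  simp only [Pi.add_apply, hC1, hC3, hC5, hF1, hF3, hF5, hH1, hH3, hH5] at q1 q2 q3 q4 q5 q6
  have m11 : m 1 1 = 0 := by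
    have : m 1 1 * (C 0 * C 2 - C 4 ^ 2) = 0 := by linear_combination q1
    exact (mul_eq_zero.1 this).resolve_right hdet
  rw [m11] at q1 q2 q3 q4 q5 q6
  have p1 : - m 0 1 * C 2 + m 1 2 * C 4 = 0 := by linear_combination (q2 - q4) / 2
  have p2 : m 0 1 * C 4 - m 1 2 * C 0 = 0 := by linear_combination (q3 - q5) / 2
  have m01 : m 0 1 = 0 := by
    have : m 0 1 * (C 0 * C 2 - C 4 ^ 2) = 0 := by linear_combination - C 0 * p1 - C 4 * p2
    exact (mul_eq_zero.1 this).resolve_right hdet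
  have m12 : m 1 2 = 0 := by
    have : m 1 2 * (C 0 * C 2 - C 4 ^ 2) = 0 := by linear_combination - C 4 * p1 - C 2 * p2
    exact (mul_eq_zero.1 this).resolve_right hdet
  rw [m01, m12] at q4 q5 q6
  have m22 : m 2 2 = 0 := by linear_combination - q4
  have m00 : m 0 0 = 0 := by linear_combination - q5
  rw [m00, m22] at q6
  have m02 : m 0 2 = 0 := by linear_combination q6 / 2
  exact sym_zero hm m00 m11 m22 m01 m02 m12

lemma core_prod {K : Submodule ℂ (Fin 6 → ℂ)} (hK3 : Module.finrank ℂ K = 3) (hK : NoV K)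
    {m : Matrix (Fin 3) (Fin 3) ℂ} (hm : mᵀ = m) (hq : ∀ a ∈ K, qf m a = 0) (h5 : ∀ a ∈ K, a 5 = 0) :
    m = 0 := by
  obtain ⟨⟨C, hC, hC0, hC2, hC4⟩, hsurj⟩ := two_coord K hK3 2 4
  have hs := hsurj (fun x hx y hy a b c d => depA hK hx hy a b (h5 x hx) c d (h5 y hy))
  obtain ⟨⟨D, hD, hD0, hD1, hD3⟩, hsurj'⟩ := two_coord K hK3 1 3
  have hs' := hsurj' (fun x hx y hy a b c d => depB hK hx hy a b (h5 x hx) c d (h5 y hy))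
  have hC5 := h5 C hC
  have hD5 := h5 D hD
  have hdet : C 0 * C 1 - C 3 ^ 2 ≠ 0 := by
    intro h
    exact hC0 (rankA hK hC hC2 hC4 hC5 (by linear_combination h))
  have hdet' : D 0 * D 2 - D 4 ^ 2 ≠ 0 := by
    intro h
    exact hD0 (rankB hK hD hD1 hD3 hD5 (by linear_combination h))
  have q1 := hq C hC
  have q2 := hq D hD
  rw [qf_expand hm] at q1 q2
  simp only [hC2, hC4, hC5, hD1, hD3, hD5] at q1 q2
  have m22 : m 2 2 = 0 := by
    have : m 2 2 * (C 0 * C 1 - C 3 ^ 2) = 0 := by linear_combination q1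
    exact (mul_eq_zero.1 this).resolve_right hdet
  have m11 : m 1 1 = 0 := by
    have : m 1 1 * (D 0 * D 2 - D 4 ^ 2) = 0 := by linear_combination q2
    exact (mul_eq_zero.1 this).resolve_right hdet'
  set b : (Fin 6 → ℂ) → (Fin 6 → ℂ) → ℂ := fun x y =>
    x 1 * (m 0 0 * y 2 - 2 * m 0 2 * y 4) + x 3 * (- 2 * m 0 1 * y 2 + 2 * m 1 2 * y 4) with hb
  have hself : ∀ x ∈ K, b x x = 0 := by
    intro x hx
    have := hq x hx
    rw [qf_expand hm, m11, m22, h5 x hx] at this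
    simp only [hb]
    linear_combination this
  have hpol : ∀ x ∈ K, ∀ y ∈ K, b x y + b y x = 0 := by
    intro x hx y hy
    have e1 := hself (x + y) (K.add_mem hx hy)
    have e2 := hself x hx
    have e3 := hself y hy
    simp only [hb, Pi.add_apply] at e1 e2 e3 ⊢
    linear_combination e1 - e2 - e3
  have hCb : ∀ y ∈ K, b C y = 0 := by
    intro y hy
    have := hpol C hC y hy
    simp only [hb, hC2, hC4] at this ⊢
    linear_combination this
  have hDb : ∀ x ∈ K, b x D = 0 := by
    intro x hx
    have := hpol x hx D hD
    simp only [hb, hD1, hD3] at this ⊢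
    linear_combination this
  have hall : ∀ x ∈ K, ∀ y ∈ K, b x y = 0 := by
    intro x hx y hy
    have hnli : ¬ LinearIndependent ℂ ![(⟨C, hC⟩ : K), ⟨D, hD⟩, ⟨x, hx⟩, ⟨y, hy⟩] := by
      intro h
      have := h.fintype_card_le_finrank
      simp [hK3] at this
    rw [Fintype.not_linearIndependent_iff] at hnli
    obtain ⟨g, hg, i, hi⟩ := hnli
    have hg' := congrArg Subtype.val hg
    simp [Fin.sum_univ_four] at hg'
    have r : ∀ k, g 0 * C k + g 1 * D k + g 2 * x k + g 3 * y k = 0 := by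
      intro k
      simpa using congrFun hg' k
    have c1 := hCb y hy
    have c2 := hDb x hx
    have c3 := hself x hx
    have c4 := hself y hy
    simp only [hb] at c1 c2 c3 c4 ⊢
    by_cases h2 : g 2 = 0
    · by_cases h3 : g 3 = 0
      · exfalso
        rw [h2, h3] at r
        have r1 := r 1
        have r3 := r 3
        have r2 := r 2
        have r4 := r 4
        rw [hD1] at r1
        rw [hD3] at r3
        rw [hC2] at r2
        rw [hC4] at r4
        have z0 : g 0 = 0 := by
          by_contra hne
          have y1 : C 1 = 0 := by
            have : g 0 * C 1 = 0 := by linear_combination r1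
            exact (mul_eq_zero.1 this).resolve_left hne
          have y3 : C 3 = 0 := by
            have : g 0 * C 3 = 0 := by linear_combination r3
            exact (mul_eq_zero.1 this).resolve_left hne
          apply hdet; rw [y1, y3]; ring
        have z1 : g 1 = 0 := by
          by_contra hne
          have y2 : D 2 = 0 := by
            have : g 1 * D 2 = 0 := by linear_combination r2
            exact (mul_eq_zero.1 this).resolve_left hne
          have y4 : D 4 = 0 := by
            have : g 1 * D 4 = 0 := by linear_combination r4
            exact (mul_eq_zero.1 this).resolve_left hne
          apply hdet'; rw [y2, y4]; ring
        fin_cases i <;> simp_all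
      · apply (mul_eq_zero.1 (?_ : g 3 * _ = 0)).resolve_left h3
        have r2 := r 2
        have r4 := r 4
        rw [hC2] at r2
        rw [hC4] at r4
        linear_combination (m 0 0 * x 1 - 2 * m 0 1 * x 3) * r2 + (-2 * m 0 2 * x 1 + 2 * m 1 2 * x 3) * r4
          - g 1 * c2 - g 2 * c3
    · apply (mul_eq_zero.1 (?_ : g 2 * _ = 0)).resolve_left h2
      have r1 := r 1
      have r3 := r 3
      rw [hD1] at r1
      rw [hD3] at r3
      linear_combination (m 0 0 * y 2 - 2 * m 0 2 * y 4) * r1 + (- 2 * m 0 1 * y 2 + 2 * m 1 2 * y 4) * r3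
          - g 0 * c1 - g 3 * c4
  obtain ⟨x0, hx0, x01, x03⟩ := hs' 1 0
  obtain ⟨x1, hx1, x11, x13⟩ := hs' 0 1
  obtain ⟨y0, hy0, y02, y04⟩ := hs 1 0
  obtain ⟨y1, hy1, y12, y14⟩ := hs 0 1
  have e1 := hall x0 hx0 y0 hy0
  have e2 := hall x0 hx0 y1 hy1
  have e3 := hall x1 hx1 y0 hy0
  have e4 := hall x1 hx1 y1 hy1
  simp only [hb, x01, x03, x11, x13, y02, y04, y12, y14] at e1 e2 e3 e4
  exact sym_zero hm (by linear_combination e1) m11 m22 (by linear_combination - e3 / 2)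
    (by linear_combination - e2 / 2) (by linear_combination e4 / 2)

/-- the change of basis on quadratic data -/
def TQ (Q : Matrix (Fin 3) (Fin 3) ℂ) : Matrix (Fin 6) (Fin 6) ℂ :=
  Matrix.of ![op (Q 0) (Q 0), op (Q 1) (Q 1), op (Q 2) (Q 2), op (Q 0) (Q 1), op (Q 0) (Q 2), op (Q 1) (Q 2)]

lemma opc_comm (l m : Fin 3 → ℂ) : op l m = op m l := by
  ext i; fin_cases i <;> simp [op] <;> ring

lemma sm_TQ (Q : Matrix (Fin 3) (Fin 3) ℂ) (a) : sm (TQ Q *ᵥ a) = Q * sm a * Qᵀ := by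
  ext i j
  rw [congr_entry]
  fin_cases i <;> fin_cases j <;> simp [sm, TQ, mulVec, opc_comm (Q 1) (Q 0), opc_comm (Q 2) (Q 0), opc_comm (Q 2) (Q 1)]

lemma core_basis {K : Submodule ℂ (Fin 6 → ℂ)} (hK3 : Module.finrank ℂ K = 3) (hK : NoV K)
    {m : Matrix (Fin 3) (Fin 3) ℂ} (hm : mᵀ = m) (hq : ∀ a ∈ K, qf m a = 0)
    (Q : Matrix (Fin 3) (Fin 3) ℂ) (hQ : Q.det ≠ 0)
    (h : (∀ a ∈ K, op (Q 1) (Q 2) ⬝ᵥ a = 0) ∨ (∀ a ∈ K, op (Q 1) (Q 1) ⬝ᵥ a = 0)) : m = 0 := by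
  have hinj : Function.Injective (TQ Q).mulVecLin := by
    rw [← LinearMap.ker_eq_bot, LinearMap.ker_eq_bot']
    intro a ha
    have h1 := sm_TQ Q a
    have ha' : TQ Q *ᵥ a = 0 := by simpa using ha
    have h0 : sm (0 : Fin 6 → ℂ) = 0 := by
      ext i j; fin_cases i <;> fin_cases j <;> simp [sm]
    rw [ha', h0] at h1
    have := congr_zero hQ h1.symm
    rw [← h0] at this
    exact sm_inj this
  set K' := K.map (TQ Q).mulVecLin with hK'
  have h3 : Module.finrank ℂ K' = 3 := by
    rw [hK', ← (Submodule.equivMapOfInjective _ hinj K).finrank_eq, hK3]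
  have hNoV : NoV K' := by
    rintro z ⟨a, ha, hz⟩
    have hz' : TQ Q *ᵥ a = mv z := by simpa using hz
    have h1 := sm_TQ Q a
    have hu : IsUnit Q.det := hQ.isUnit
    have h2 : sm (mv (Q⁻¹ *ᵥ z)) = sm a := by
      have e : Q⁻¹ * (Q * sm a * Qᵀ) * Q⁻¹ᵀ = sm a := by
        have e2 : Qᵀ * Q⁻¹ᵀ = 1 := by rw [← transpose_mul, nonsing_inv_mul _ hu, transpose_one]
        rw [Matrix.mul_assoc Q, nonsing_inv_mul_cancel_left _ _ hu, Matrix.mul_assoc, e2, Matrix.mul_one]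
      rw [← e, ← h1, hz', sm_mv, sm_mv, Matrix.mul_vecMulVec, vecMulVec_mul, vecMul_transpose]
    have h4 := hK (Q⁻¹ *ᵥ z) (by rw [sm_inj h2]; exact ha)
    have : Q *ᵥ (Q⁻¹ *ᵥ z) = 0 := by rw [h4, mulVec_zero]
    rwa [mulVec_mulVec, mul_nonsing_inv _ hu, one_mulVec] at this
  have hm' : (Q * m * Qᵀ)ᵀ = Q * m * Qᵀ := by
    rw [transpose_mul, transpose_mul, transpose_transpose, hm, Matrix.mul_assoc]
  have hq' : ∀ a ∈ K', qf (Q * m * Qᵀ) a = 0 := by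
    rintro _ ⟨a, ha, rfl⟩
    rw [mulVecLin_apply, qf, sm_TQ, adjugate_mul_distrib, adjugate_mul_distrib]
    have e : Q * m * Qᵀ * (Qᵀ.adjugate * ((sm a).adjugate * Q.adjugate))
        = Q * (m * ((Qᵀ * Qᵀ.adjugate) * ((sm a).adjugate * Q.adjugate))) := by
      simp only [Matrix.mul_assoc]
    rw [e, mul_adjugate, smul_mul, Matrix.one_mul, trace_mul_comm, Matrix.mul_assoc, smul_mul,
      Matrix.mul_assoc, adjugate_mul, Matrix.mul_smul, Matrix.mul_smul, Matrix.mul_smul, Matrix.mul_one,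
      trace_smul, trace_smul]
    have := hq a ha
    rw [qf] at this
    rw [this]; simp
  apply congr_zero hQ
  rcases h with h | h
  · apply core_prod h3 hNoV hm' hq'
    rintro _ ⟨a, ha, rfl⟩
    simpa [TQ, mulVec] using h a ha
  · apply core_sq h3 hNoV hm' hq'
    rintro _ ⟨a, ha, rfl⟩
    simpa [TQ, mulVec] using h a ha

lemma core_cases {K : Submodule ℂ (Fin 6 → ℂ)} (hK3 : Module.finrank ℂ K = 3) (hK : NoV K)
    {m : Matrix (Fin 3) (Fin 3) ℂ} (hm : mᵀ = m) (hq : ∀ a ∈ K, qf m a = 0)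
    (h : (∃ l n, LinearIndependent ℂ ![l, n] ∧ ∀ a ∈ K, op l n ⬝ᵥ a = 0) ∨
      (∃ l, l ≠ 0 ∧ ∀ a ∈ K, op l l ⬝ᵥ a = 0)) : m = 0 := by
  rcases h with ⟨l, n, hl, h⟩ | ⟨l, hl, h⟩
  · obtain ⟨r, hr⟩ := exists_third hl
    exact core_basis hK3 hK hm hq _ hr (Or.inl h)
  · obtain ⟨n, hn⟩ := exists_linearIndependent_pair_of_one_lt_finrank (R := ℂ) (M := Fin 3 → ℂ) (by simp) hl
    obtain ⟨r, hr⟩ := exists_third hn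
    exact core_basis hK3 hK hm hq _ hr (Or.inr h)

/-- complexification of vectors -/
noncomputable def cx {n : Type*} (a : n → ℝ) : n → ℂ := fun i => (a i : ℂ)

lemma cx_mulVec (G : Matrix (Fin 6) (Fin 6) ℝ) (a : Fin 6 → ℝ) :
    G.map (algebraMap ℝ ℂ) *ᵥ cx a = cx (G *ᵥ a) := by
  ext k
  exact (RingHom.map_mulVec (algebraMap ℝ ℂ) G a k).symm

lemma cx_dot {n : Type*} [Fintype n] (a b : n → ℝ) : cx a ⬝ᵥ cx b = ((a ⬝ᵥ b : ℝ) : ℂ) := by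
  simp [cx, dotProduct]

lemma cx_op (l m : Fin 3 → ℝ) : op (cx l) (cx m) = cx (op l m) := by
  ext i; fin_cases i <;> simp [op, cx]

lemma qf_MM {m : Matrix (Fin 3) (Fin 3) ℝ} (hm : mᵀ = m) (a : Fin 6 → ℂ) :
    qf (m.map (algebraMap ℝ ℂ)) a = a ⬝ᵥ ((MM m).map (algebraMap ℝ ℂ) *ᵥ a) := by
  rw [qf_expand (by rw [← transpose_map, hm])]
  simp [MM, dotProduct, mulVec, Fin.sum_univ_succ]
  ring

lemma cx_indep {B : Fin 3 → Fin 6 → ℝ} (hB : LinearIndependent ℝ B) :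
    LinearIndependent ℂ (fun i => cx (B i)) := by
  rw [Fintype.linearIndependent_iff] at hB ⊢
  intro g hg i
  have h1 := hB (fun i => (g i).re) (by
    ext k
    have := congrArg Complex.re (congrFun hg k)
    simpa [cx, Finset.sum_apply] using this) i
  have h2 := hB (fun i => (g i).im) (by
    ext k
    have := congrArg Complex.im (congrFun hg k)
    simpa [cx, Finset.sum_apply] using this) i
  exact Complex.ext h1 h2

lemma opc_bilin (l m : Fin 3 → ℂ) (s t : ℂ) :
    op (s • l + t • m) (s • l + (-t) • m) = s ^ 2 • op l l + (-(t ^ 2)) • op m m := by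
  ext i; fin_cases i <;> simp [op] <;> ring

lemma cx_pair {b : Fin 3 → Fin 3 → ℝ} (hb : ∀ i j, b i ⬝ᵥ b j = if i = j then 1 else 0)
    {i j : Fin 3} (hij : i ≠ j) (s t : ℂ) (hs : s ≠ 0) (ht : t ≠ 0) :
    LinearIndependent ℂ ![s • cx (b i) + t • cx (b j), s • cx (b i) + (-t) • cx (b j)] := by
  rw [LinearIndependent.pair_iff]
  intro x y h
  have e1 := congrArg (fun z => cx (b i) ⬝ᵥ z) h
  have e2 := congrArg (fun z => cx (b j) ⬝ᵥ z) h
  simp only [dotProduct_add, dotProduct_smul, cx_dot, hb, hij, hij.symm, dotProduct_zero, smul_eq_mul] at e1 e2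
  simp at e1 e2
  have f1 : s * (x + y) = 0 := by linear_combination e1
  have f2 : t * (x - y) = 0 := by linear_combination e2
  have f1' := (mul_eq_zero.1 f1).resolve_left hs
  have f2' := (mul_eq_zero.1 f2).resolve_left ht
  constructor
  · linear_combination (f1' + f2') / 2
  · linear_combination (f1' - f2') / 2

lemma rigid {f : MvPolynomial (Fin 3) ℝ} (hsm : IsSmooth f) {G} (hG : G ∈ GramSpectrahedron f)
    {B : Fin 3 → Fin 6 → ℝ} (hB : LinearIndependent ℝ B) (hker : ∀ i, G *ᵥ B i = 0)
    {m : Matrix (Fin 3) (Fin 3) ℝ} (hm : mᵀ = m) (h : ∀ i j, B i ⬝ᵥ (MM m *ᵥ B j) = 0) : m = 0 := by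
  set K := Submodule.span ℂ (Set.range fun i => cx (B i)) with hK
  have hK3 : Module.finrank ℂ K = 3 := by
    rw [hK, finrank_span_eq_card (cx_indep hB)]; simp
  have hrep : ∀ a ∈ K, ∃ c : Fin 3 → ℂ, a = ∑ i, c i • cx (B i) := by
    intro a ha
    obtain ⟨c, hc⟩ := (Submodule.mem_span_range_iff_exists_fun ℂ).1 ha
    exact ⟨c, hc.symm⟩
  have hNoV : NoV K := by
    intro z hz
    obtain ⟨c, hc⟩ := hrep _ hz
    rw [mem_gram] at hG
    apply smooth_gram hsm (psd_symm hG.1) hG.2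
    intro i
    have : G.map (algebraMap ℝ ℂ) *ᵥ mv z = 0 := by
      rw [hc, mulVec_sum]
      apply Finset.sum_eq_zero
      intro i _
      rw [mulVec_smul, cx_mulVec, hker]
      ext; simp [cx]
    rw [this, dotProduct_zero]
  have hq : ∀ a ∈ K, qf (m.map (algebraMap ℝ ℂ)) a = 0 := by
    intro a ha
    obtain ⟨c, rfl⟩ := hrep a ha
    rw [qf_MM hm, mulVec_sum, sum_dotProduct]
    apply Finset.sum_eq_zero
    intro i _
    rw [dotProduct_sum]
    apply Finset.sum_eq_zero
    intro j _
    rw [mulVec_smul, cx_mulVec, smul_dotProduct, dotProduct_smul, cx_dot, h]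
    simp
  -- the singular quadric
  set W := LinearMap.ker (Matrix.of B).mulVecLin with hW
  have hW2 : 2 ≤ Module.finrank ℝ W := by
    have h1 := (Matrix.of B).mulVecLin.finrank_range_add_finrank_ker
    have h2 := Submodule.finrank_le (LinearMap.range (Matrix.of B).mulVecLin)
    rw [← hW] at h1
    simp at h1 h2
    omega
  obtain ⟨p, hp, hp0, hdet⟩ := exists_singular W hW2
  have hpB : ∀ i, p ⬝ᵥ B i = 0 := by
    intro i
    have : (Matrix.of B) *ᵥ p = 0 := by simpa [hW] using hp
    have := congrFun this i
    rw [dotProduct_comm]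
    simpa [mulVec] using this
  have hpK : ∀ a ∈ K, cx p ⬝ᵥ a = 0 := by
    intro a ha
    obtain ⟨c, rfl⟩ := hrep a ha
    rw [dotProduct_sum]
    apply Finset.sum_eq_zero
    intro i _
    rw [dotProduct_smul, cx_dot, hpB]
    simp
  obtain ⟨b, d, hb, hpd, hd⟩ := qm_diag p
  have hdk : ∃ i j : Fin 3, i ≠ j ∧ p = d i • op (b i) (b i) + d j • op (b j) (b j) := by
    rw [hdet] at hd
    rcases mul_eq_zero.1 hd.symm with h' | h'
    · rcases mul_eq_zero.1 h' with h'' | h''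
      · exact ⟨1, 2, by decide, by rw [hpd, h'']; simp⟩
      · exact ⟨0, 2, by decide, by rw [hpd, h'']; simp⟩
    · exact ⟨0, 1, by decide, by rw [hpd, h']; simp⟩
  obtain ⟨i, j, hij, hpij⟩ := hdk
  have hb0 : ∀ i, cx (b i) ≠ 0 := by
    intro i h0
    have := cx_dot (b i) (b i)
    rw [h0, hb] at this
    simp at this
  have hcp : cx p = (d i : ℂ) • op (cx (b i)) (cx (b i)) + (d j : ℂ) • op (cx (b j)) (cx (b j)) := by
    rw [cx_op, cx_op, hpij]
    ext k
    simp [cx]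
  have hsq : ∀ (i : Fin 3) (c : ℝ), p = c • op (b i) (b i) → ∀ a ∈ K, op (cx (b i)) (cx (b i)) ⬝ᵥ a = 0 := by
    intro i c hc a ha
    have hc0 : (c : ℂ) ≠ 0 := by
      intro h0
      apply hp0
      have : c = 0 := by exact_mod_cast h0
      rw [hc, this, zero_smul]
    have h1 := hpK a ha
    have h2 : cx p = (c : ℂ) • op (cx (b i)) (cx (b i)) := by
      rw [cx_op, hc]; ext k; simp [cx]
    rw [h2, smul_dotProduct, smul_eq_mul] at h1
    exact (mul_eq_zero.1 h1).resolve_left hc0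
  have hz : m.map (algebraMap ℝ ℂ) = 0 := by
    apply core_cases hK3 hNoV (by rw [← transpose_map, hm]) hq
    by_cases hi : d i = 0
    · right
      exact ⟨cx (b j), hb0 j, hsq j (d j) (by rw [hpij, hi]; simp)⟩
    by_cases hj : d j = 0
    · right
      exact ⟨cx (b i), hb0 i, hsq i (d i) (by rw [hpij, hj]; simp)⟩
    left
    obtain ⟨s, hs⟩ := IsAlgClosed.exists_eq_mul_self (d i : ℂ)
    obtain ⟨t, ht⟩ := IsAlgClosed.exists_eq_mul_self (-(d j : ℂ))
    have hs0 : s ≠ 0 := by rintro rfl; simp at hs; exact hi hs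
    have ht0 : t ≠ 0 := by rintro rfl; simp at ht; exact hj ht
    refine ⟨_, _, cx_pair hb hij s t hs0 ht0, ?_⟩
    rw [opc_bilin, pow_two, pow_two, ← hs, ← ht, neg_neg, ← hcp]
    exact hpK
  ext i j
  have := congrFun (congrFun hz i) j
  simpa using this

lemma entry_bound {G : Matrix (Fin 6) (Fin 6) ℝ} (hG : G.PosSemidef) {c : ℝ}
    (h : ∀ i, G i i ≤ c) (i j) : G i j ∈ Set.Icc (-c) c := by
  have e1 := psd_nonneg hG (Pi.single i 1 + Pi.single j 1)
  have e2 := psd_nonneg hG (Pi.single i 1 - Pi.single j 1)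
  have hs := bil_symm hG (Pi.single i 1) (Pi.single j 1)
  simp only [mulVec_add, mulVec_sub, dotProduct_add, add_dotProduct, sub_dotProduct, dotProduct_sub] at e1 e2
  simp at e1 e2 hs
  have h1 := h i
  have h2 := h j
  constructor <;> linarith

lemma gram_bounded (f : MvPolynomial (Fin 3) ℝ) :
    ∃ c : ℝ, ∀ G ∈ GramSpectrahedron f, ∀ i j, G i j ∈ Set.Icc (-c) c := by
  let F : (Fin 3 → ℝ) → ℝ := fun v => |eval v f|
  refine ⟨F ![1,0,0] + F ![0,1,0] + F ![0,0,1] + F ![1,1,0] + F ![1,-1,0] + F ![1,0,1] + F ![1,0,-1]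
    + F ![0,1,1] + F ![0,1,-1], ?_⟩
  intro G hG
  rw [mem_gram] at hG
  apply entry_bound hG.1
  have hF : ∀ v, mv v ⬝ᵥ (G *ᵥ mv v) ≤ F v := fun v => by rw [hG.2]; exact le_abs_self _
  have hF0 : ∀ v, 0 ≤ F v := fun v => abs_nonneg _
  have a1 := hF ![1,0,0]
  have a2 := hF ![0,1,0]
  have a3 := hF ![0,0,1]
  have a4 := hF ![1,1,0]
  have a5 := hF ![1,-1,0]
  have a6 := hF ![1,0,1]
  have a7 := hF ![1,0,-1]
  have a8 := hF ![0,1,1]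
  have a9 := hF ![0,1,-1]
  have p1 := psd_nonneg hG.1 ![1,1,0,0,0,0]
  have p2 := psd_nonneg hG.1 ![1,0,1,0,0,0]
  have p3 := psd_nonneg hG.1 ![0,1,1,0,0,0]
  have q1 := psd_nonneg hG.1 ![0,0,0,1,0,0]
  have q2 := psd_nonneg hG.1 ![0,0,0,0,1,0]
  have q3 := psd_nonneg hG.1 ![0,0,0,0,0,1]
  have b1 := hF0 ![1,0,0]
  have b2 := hF0 ![0,1,0]
  have b3 := hF0 ![0,0,1]
  have b4 := hF0 ![1,1,0]
  have b5 := hF0 ![1,-1,0]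
  have b6 := hF0 ![1,0,1]
  have b7 := hF0 ![1,0,-1]
  have b8 := hF0 ![0,1,1]
  have b9 := hF0 ![0,1,-1]
  clear_value F
  simp [mv, dotProduct, mulVec, Fin.sum_univ_succ] at a1 a2 a3 a4 a5 a6 a7 a8 a9 p1 p2 p3 q1 q2 q3
  intro i
  fin_cases i <;> simp <;> linarith

lemma gram_closed (f : MvPolynomial (Fin 3) ℝ) : IsClosed (GramSpectrahedron f) := by
  have : GramSpectrahedron f = {G | Gᵀ = G} ∩ (⋂ a, {G | 0 ≤ a ⬝ᵥ (G *ᵥ a)}) ∩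
      (⋂ v, {G | mv v ⬝ᵥ (G *ᵥ mv v) = eval v f}) := by
    ext G
    simp only [Set.mem_inter_iff, Set.mem_iInter, Set.mem_setOf_eq]
    rw [mem_gram]
    exact and_congr_left fun _ => ⟨fun h => ⟨psd_symm h, psd_nonneg h⟩, fun h => psd_of h.1 h.2⟩
  rw [this]
  refine (IsClosed.inter ?_ (isClosed_iInter fun a => ?_)).inter (isClosed_iInter fun v => ?_)
  · exact isClosed_eq (by fun_prop) (by fun_prop)
  · exact isClosed_le (by fun_prop) (by fun_prop)
  · exact isClosed_eq (by fun_prop) (by fun_prop)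

lemma gram_compact (f : MvPolynomial (Fin 3) ℝ) : IsCompact (GramSpectrahedron f) := by
  obtain ⟨c, hc⟩ := gram_bounded f
  have h : IsCompact (Set.pi Set.univ fun _ : Fin 6 => Set.pi Set.univ fun _ : Fin 6 => Set.Icc (-c) c) :=
    isCompact_univ_pi fun i => isCompact_univ_pi fun j => isCompact_Icc
  exact IsCompact.of_isClosed_subset h (gram_closed f) fun G hG i _ j _ => hc G hG i j

lemma cont_mu : Continuous mu := by
  unfold mu
  refine continuous_matrix fun i j => ?_
  fin_cases i <;> fin_cases j <;> simp <;> fun_prop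

lemma cont_MM : Continuous MM := by
  unfold MM
  refine continuous_matrix fun i j => ?_
  fin_cases i <;> fin_cases j <;> simp <;> fun_prop

lemma exists_min {f : MvPolynomial (Fin 3) ℝ} (h : (GramSpectrahedron f).Nonempty) (N) : ∃ G, IsMn f N G := by
  obtain ⟨G, hG, hm⟩ := (gram_compact f).exists_isMinOn h
    (f := fun G => (mu G * N).trace) (by have := cont_mu; fun_prop)
  exact ⟨G, hG, fun H hH => hm hH⟩

def ON3 (B : Fin 3 → Fin 6 → ℝ) : Prop := ∀ i j, B i ⬝ᵥ B j = if i = j then 1 else 0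

lemma ON3_li {B} (h : ON3 B) : LinearIndependent ℝ B := by
  rw [Fintype.linearIndependent_iff]
  intro g hg i
  have := congrArg (fun x => B i ⬝ᵥ x) hg
  simpa [dotProduct_sum, h i] using this

lemma ON3_compact : IsCompact {B | ON3 B} := by
  have h : IsCompact (Set.pi Set.univ fun _ : Fin 3 => Set.pi Set.univ fun _ : Fin 6 => Set.Icc (-1 : ℝ) 1) :=
    isCompact_univ_pi fun i => isCompact_univ_pi fun j => isCompact_Icc
  refine IsCompact.of_isClosed_subset h ?_ ?_
  · simp only [ON3, Set.setOf_forall]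
    exact isClosed_iInter fun i => isClosed_iInter fun j => isClosed_eq (by fun_prop) (by fun_prop)
  · intro B hB i _ j _
    have h1 := hB i i
    simp only [if_true, dotProduct] at h1
    have h2 : B i j * B i j ≤ ∑ k, B i k * B i k :=
      Finset.single_le_sum (f := fun k => B i k * B i k) (fun k _ => mul_self_nonneg _) (Finset.mem_univ j)
    rw [h1] at h2
    exact abs_le.1 ((abs_le_one_iff_mul_self_le_one).2 h2)

lemma exists_ON3 (W : Submodule ℝ (Fin 6 → ℝ)) (h : 3 ≤ Module.finrank ℝ W) :
    ∃ B, ON3 B ∧ ∀ i, B i ∈ W := by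
  let e := WithLp.linearEquiv 2 ℝ (Fin 6 → ℝ)
  let V : Submodule ℝ (EuclideanSpace ℝ (Fin 6)) := W.comap e.toLinearMap
  have hV : Module.finrank ℝ V = Module.finrank ℝ W := by
    have : V = W.map e.symm.toLinearMap := by
      ext x; simp [V]
    rw [this]
    exact LinearEquiv.finrank_map_eq e.symm W
  let b := stdOrthonormalBasis ℝ V
  have h3 : 3 ≤ Module.finrank ℝ V := by omega
  refine ⟨fun i => e (b (Fin.castLE h3 i)), fun i j => ?_, fun i => (b (Fin.castLE h3 i)).2⟩
  have := (orthonormal_iff_ite.1 b.orthonormal) (Fin.castLE h3 j) (Fin.castLE h3 i)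
  simp [PiLp.inner_apply, EuclideanSpace.inner_eq_star_dotProduct] at this
  simp only [eq_comm (a := i)]
  exact this

lemma no_accum {f : MvPolynomial (Fin 3) ℝ} (hsm : IsSmooth f) {G : Matrix (Fin 6) (Fin 6) ℝ}
    (hG : G ∈ GramSpectrahedron f) {u : ℕ → Matrix (Fin 6) (Fin 6) ℝ}
    (hu : ∀ n, u n ∈ GramSpectrahedron f) (hne : ∀ n, u n ≠ G)
    (hk : ∀ n, 3 ≤ Module.finrank ℝ (LinearMap.ker (u n).mulVecLin))
    (hlim : Filter.Tendsto u Filter.atTop (nhds G)) : False := by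
  choose B hB hBk using fun n => exists_ON3 _ (hk n)
  have hBk' : ∀ n i, u n *ᵥ B n i = 0 := fun n i => by simpa using hBk n i
  let nm : Matrix (Fin 6) (Fin 6) ℝ → ℝ := fun D => ‖(fun i j => D i j : Fin 6 → Fin 6 → ℝ)‖
  let D : ℕ → Fin 6 → Fin 6 → ℝ := fun n i j => (nm (u n - G))⁻¹ * (u n - G) i j
  have hnm : ∀ n, nm (u n - G) ≠ 0 := by
    intro n h0
    apply hne n
    rw [← sub_eq_zero]
    have := norm_eq_zero.1 h0
    ext i j
    exact congrFun (congrFun this i) j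
  have hD : ∀ n, D n ∈ Metric.sphere (0 : Fin 6 → Fin 6 → ℝ) 1 := by
    intro n
    have : D n = (nm (u n - G))⁻¹ • (fun i j => (u n - G) i j : Fin 6 → Fin 6 → ℝ) := rfl
    rw [mem_sphere_zero_iff_norm, this, norm_smul, norm_inv, Real.norm_of_nonneg (norm_nonneg _)]
    exact inv_mul_cancel₀ (hnm n)
  obtain ⟨⟨D', B'⟩, ⟨hD', hB'⟩, φ, hφ, hl⟩ := ((isCompact_sphere (0 : Fin 6 → Fin 6 → ℝ) 1).prod
    ON3_compact).tendsto_subseq (x := fun n => (D n, B n)) fun n => ⟨hD n, hB n⟩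
  have hl1 : Filter.Tendsto (fun n => (Matrix.of (D (φ n)))) Filter.atTop (nhds (Matrix.of D')) :=
    (continuous_fst.tendsto _).comp hl
  have hl2 : Filter.Tendsto (fun n => B (φ n)) Filter.atTop (nhds B') :=
    (continuous_snd.tendsto _).comp hl
  have hl3 := hlim.comp hφ.tendsto_atTop
  have hl4 : ∀ i, Filter.Tendsto (fun n => B (φ n) i) Filter.atTop (nhds (B' i)) := fun i =>
    ((continuous_apply i).tendsto _).comp hl2
  have hDs : ∀ n, Matrix.of (D n) = (nm (u n - G))⁻¹ • (u n - G) := fun n => rfl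
  have hDM : Matrix.of D' = MM (mu (Matrix.of D')) := by
    have h1 := (cont_MM.comp cont_mu).tendsto (Matrix.of D')
    refine tendsto_nhds_unique hl1 ((h1.comp hl1).congr fun n => ?_)
    simp only [Function.comp]
    rw [hDs, mu_smul, MM_smul, mu_sub, ← gram_sub hG (hu _)]
  have hc : Continuous fun z : Matrix (Fin 6) (Fin 6) ℝ × (Fin 6 → ℝ) => z.1 *ᵥ z.2 := by fun_prop
  have hker : ∀ i, G *ᵥ B' i = 0 := by
    intro i
    refine tendsto_nhds_unique ((hc.tendsto (G, B' i)).comp (hl3.prodMk_nhds (hl4 i))) ?_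
    refine tendsto_const_nhds.congr fun n => ?_
    simp [hBk']
  have hz : ∀ i j, B' i ⬝ᵥ (Matrix.of D' *ᵥ B' j) = 0 := by
    intro i j
    have hc2 : Continuous fun z : (Fin 6 → ℝ) × Matrix (Fin 6) (Fin 6) ℝ => z.1 ⬝ᵥ (z.2 *ᵥ B' j) := by fun_prop
    refine tendsto_nhds_unique ((hc2.tendsto (B' i, Matrix.of D')).comp ((hl4 i).prodMk_nhds hl1)) ?_
    refine tendsto_const_nhds.congr fun n => ?_
    simp only [Function.comp]
    rw [hDs, smul_mulVec, dotProduct_smul, sub_mulVec, hker, sub_zero, bil_symm (hu _).1, hBk']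
    simp
  rw [hDM] at hz
  have h0 := rigid hsm hG (ON3_li hB') hker (mu_symm _) hz
  rw [h0] at hDM
  have hMM0 : MM 0 = 0 := by simpa using MM_smul 0 0
  rw [hMM0] at hDM
  have : D' = 0 := hDM
  rw [this] at hD'
  simp at hD'

def NN (v : Fin 3 → ℝ) : Matrix (Fin 3) (Fin 3) ℝ := (v ⬝ᵥ v) • 1 - (3 : ℝ) • vecMulVec v v

lemma NN_symm (v) : (NN v)ᵀ = NN v := by
  ext i j
  fin_cases i <;> fin_cases j <;> simp [NN, vecMulVec_apply] <;> ring

lemma NN_det {v : Fin 3 → ℝ} (hv : v ≠ 0) : (NN v).det < 0 := by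
  have h : (NN v).det = -2 * (v ⬝ᵥ v) ^ 3 := by
    rw [det_fin_three]
    simp [NN, vecMulVec_apply, dotProduct, Fin.sum_univ_succ]
    ring
  have h2 : 0 < v ⬝ᵥ v := by
    have := dotProduct_star_self_pos_iff (v := v)
    simpa using this.2 hv
  rw [h]
  have := pow_pos h2 3
  linarith

lemma NN_cont : Continuous NN := by
  unfold NN
  fun_prop

theorem exists_rank_four_extreme_point
    (f : MvPolynomial (Fin 3) ℝ) (hhom : f.IsHomogeneous 4)
    (hsm : IsSmooth f) (hpsd : IsPsd f) :
    ∃ G ∈ GramSpectrahedron f, G.rank = 4 ∧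
      G ∈ Set.extremePoints ℝ (GramSpectrahedron f) := by
  obtain ⟨G0, hs0, hG0⟩ := exists_gram f hhom
  obtain ⟨m, hm, hp⟩ := exists_pos G0 hs0 (fun v hv => pos_def hsm hpsd hs0 hG0 v hv)
  set Gs := G0 + MM m with hGsd
  have hGs : Gs ∈ GramSpectrahedron f := by
    rw [mem_gram]
    refine ⟨psd_of (by rw [hGsd, transpose_add, hs0, MM_symm]) fun a => ?_, fun v => ?_⟩
    · by_cases ha : a = 0
      · simp [ha]
      · exact (hp a ha).le
    · rw [hGsd, add_mulVec, dotProduct_add, hG0, MM_mv, add_zero]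
  choose g hg using fun N => exists_min ⟨Gs, hGs⟩ N
  by_contra hcon
  have hk3 : ∀ v : Fin 3 → ℝ, v ≠ 0 → 3 ≤ Module.finrank ℝ (LinearMap.ker (g (NN v)).mulVecLin) := by
    intro v hv
    have h2 := min_ker_two (hg (NN v)) hGs hp (NN_symm v) (NN_det hv)
    by_contra h3
    apply hcon
    refine ⟨_, (hg (NN v)).1, ?_, min_extreme (hg (NN v)) hGs hp (NN_symm v) (NN_det hv).ne⟩
    have h4 := (g (NN v)).mulVecLin.finrank_range_add_finrank_ker
    rw [Matrix.rank]
    simp at h4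
    omega
  have hlc : IsLocallyConstant (fun v : ({0}ᶜ : Set (Fin 3 → ℝ)) => g (NN v)) := by
    rw [IsLocallyConstant.iff_eventually_eq]
    intro v
    by_contra hev
    obtain ⟨w, hw, hne⟩ := Filter.exists_seq_forall_of_frequently (Filter.not_eventually.1 hev)
    haveI : FirstCountableTopology (Matrix (Fin 6) (Fin 6) ℝ) :=
      inferInstanceAs (FirstCountableTopology (Fin 6 → Fin 6 → ℝ))
    obtain ⟨G', hG', φ, hφ, hl⟩ := (gram_compact f).tendsto_subseq (x := fun n => g (NN (w n)))
      fun n => (hg _).1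
    have hNl : Filter.Tendsto (fun n => NN (w (φ n))) Filter.atTop (nhds (NN v)) :=
      ((NN_cont.comp continuous_subtype_val).tendsto v).comp (hw.comp hφ.tendsto_atTop)
    have hmin : IsMn f (NN v) G' := by
      refine ⟨hG', fun H hH => ?_⟩
      have hc : Continuous fun z : Matrix (Fin 6) (Fin 6) ℝ × Matrix (Fin 3) (Fin 3) ℝ => (mu z.1 * z.2).trace := by
        have := cont_mu
        fun_prop
      have hc2 : Continuous fun z : Matrix (Fin 3) (Fin 3) ℝ => (mu H * z).trace := by
        fun_prop
      exact le_of_tendsto_of_tendsto' ((hc.tendsto (G', NN v)).comp (hl.prodMk_nhds hNl))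
        ((hc2.tendsto _).comp hNl) fun n => (hg _).2 H hH
    have e := min_unique hmin (hg (NN v)) hGs hp (NN_symm _) (NN_det v.2).ne
    exact no_accum hsm hG' (u := fun n => g (NN (w (φ n)))) (fun n => (hg _).1)
      (fun n => by rw [e]; exact hne _) (fun n => hk3 _ (w (φ n)).2) hl
  have hpc : PreconnectedSpace ({0}ᶜ : Set (Fin 3 → ℝ)) := by
    rw [← isPreconnected_iff_preconnectedSpace]
    refine (isConnected_compl_singleton_of_one_lt_rank ?_ 0).isPreconnected
    simp
  have hconst : ∀ v w : Fin 3 → ℝ, v ≠ 0 → w ≠ 0 → g (NN v) = g (NN w) := fun v w hv hw =>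
    hlc.apply_eq_of_preconnectedSpace ⟨v, hv⟩ ⟨w, hw⟩
  have n1 : (![1,0,0] : Fin 3 → ℝ) ≠ 0 := fun h => by simpa using congrFun h 0
  have n2 : (![0,1,0] : Fin 3 → ℝ) ≠ 0 := fun h => by simpa using congrFun h 1
  have n3 : (![0,0,1] : Fin 3 → ℝ) ≠ 0 := fun h => by simpa using congrFun h 2
  have hsum : ∀ M : Matrix (Fin 3) (Fin 3) ℝ,
      (M * NN ![1,0,0]).trace + (M * NN ![0,1,0]).trace + (M * NN ![0,0,1]).trace = 0 := by
    intro M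
    simp [NN, trace_fin_three, Matrix.mul_apply, Fin.sum_univ_succ, vecMulVec_apply, dotProduct, Matrix.one_apply]
    ring
  have hGsm : IsMn f (NN ![1,0,0]) Gs := by
    refine ⟨hGs, fun H hH => ?_⟩
    have a1 := (hg (NN ![1,0,0])).2 H hH
    have a2 := (hg (NN ![0,1,0])).2 Gs hGs
    have a3 := (hg (NN ![0,0,1])).2 Gs hGs
    rw [hconst _ _ n2 n1] at a2
    rw [hconst _ _ n3 n1] at a3
    have s1 := hsum (mu Gs)
    have s2 := hsum (mu (g (NN ![1,0,0])))
    linarith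
  have h2 := min_ker_two hGsm hGs hp (NN_symm _) (NN_det n1)
  have hbot : LinearMap.ker Gs.mulVecLin = ⊥ := by
    rw [LinearMap.ker_eq_bot']
    intro a ha
    by_contra h0
    have := hp a h0
    have ha' : Gs *ᵥ a = 0 := by simpa using ha
    rw [ha'] at this
    simp at this
  rw [hbot, finrank_bot] at h2
  omega
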